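/- arXiv:1205.1356 — 11 statements merged into one kernel-verified Lean document; each statement's English description precedes it below -/
import Mathlib

section
/- Mod_p(N) = 0 if and only if there exists a measurable function f : M → [0,∞] with ∫_M f^p dμ < ∞ such that ∫_M f dν_y = ∞ for σ-almost every y ∈ N. -/
open MeasureTheory ENNReal Filter

variable {M N : Type*}

/-- `f : M → [0,∞]` is `p`-admissible for a measurable set `S ⊆ N`:
`f` is measurable, `∫_M f^p dμ < ∞`, and `∫_M f dν_y ≥ 1` for `σ`-a.e. `y ∈ S`. -/
def IsAdmissible [MeasurableSpace M] [MeasurableSpace N]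
    (μ : Measure M) (σ : Measure N) (ν : N → Measure M) (p : ℝ)
    (S : Set N) (f : M → ℝ≥0∞) : Prop :=
  Measurable f ∧ (∫⁻ x, f x ^ p ∂μ) < ∞ ∧ ∀ᵐ y ∂σ, y ∈ S → 1 ≤ ∫⁻ x, f x ∂(ν y)

/-- The `p`-modulus of `S ⊆ N`: the infimum of `(∫_M f^p dμ)^{1/p}` over all
`p`-admissible `f` for `S` (`∞` if there is no admissible function). -/
noncomputable def Modulus [MeasurableSpace M] [MeasurableSpace N]
    (μ : Measure M) (σ : Measure N) (ν : N → Measure M) (p : ℝ) (S : Set N) : ℝ≥0∞ :=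
  ⨅ (f : M → ℝ≥0∞) (_ : IsAdmissible μ σ ν p S f), (∫⁻ x, f x ^ p ∂μ) ^ (1 / p)

/-- `f₀` is extremal for the `p`-modulus: admissible for all of `N`, realizing the modulus. -/
def IsExtremal [MeasurableSpace M] [MeasurableSpace N]
    (μ : Measure M) (σ : Measure N) (ν : N → Measure M) (p : ℝ)
    (f₀ : M → ℝ≥0∞) : Prop :=
  IsAdmissible μ σ ν p Set.univ f₀ ∧
    (∫⁻ x, f₀ x ^ p ∂μ) ^ (1 / p) = Modulus μ σ ν p Set.univ

/-- Minkowski's inequality for a series of nonnegative functions. -/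
theorem lintegral_Lp_tsum_le {α : Type*} [MeasurableSpace α] {μ : Measure α} {p : ℝ} (hp : 1 ≤ p)
    {f : ℕ → α → ℝ≥0∞} (hf : ∀ n, Measurable (f n)) :
    (∫⁻ x, (∑' n, f n x) ^ p ∂μ) ^ (1 / p) ≤ ∑' n, (∫⁻ x, f n x ^ p ∂μ) ^ (1 / p) := by
  have hp0 : 0 < p := by linarith
  have hpartial (n : ℕ) : ∫⁻ x, (∑ i ∈ Finset.range n, f i x) ^ p ∂μ ≤
      (∑' n, (∫⁻ x, f n x ^ p ∂μ) ^ (1 / p)) ^ p := by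
    have h := eLpNorm'_sum_le (f := f) (s := Finset.range n) (μ := μ)
      (fun i _ => (hf i).aestronglyMeasurable) hp
    simp only [eLpNorm', enorm_eq_self, Finset.sum_apply] at h
    rw [← ENNReal.rpow_inv_le_iff hp0, ← one_div]
    exact h.trans (ENNReal.sum_le_tsum _)
  refine (le_of_eq (by rw [one_div])).trans ((ENNReal.rpow_inv_le_iff hp0).2 ?_)
  have hlim (x : α) : Tendsto (fun n => (∑ i ∈ Finset.range n, f i x) ^ p) atTop
      (nhds ((∑' n, f n x) ^ p)) :=
    (ENNReal.continuous_rpow_const.tendsto _).comp (ENNReal.tendsto_nat_tsum _)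
  refine le_of_tendsto' (lintegral_tendsto_of_tendsto_of_monotone
    (fun n => by fun_prop) (ae_of_all _ fun x m n hmn => ?_) (ae_of_all _ hlim)) hpartial
  exact ENNReal.rpow_le_rpow (Finset.sum_le_sum_of_subset (Finset.range_mono hmn)) hp0.le

theorem statement_3
    {M N : Type*} [MeasurableSpace M] [MeasurableSpace N]
    (μ : Measure M) (σ : Measure N) [SigmaFinite μ] [SigmaFinite σ]
    (ν : N → Measure M) (hνsf : ∀ y, SigmaFinite (ν y))
    (hker : ∀ A : Set M, MeasurableSet A → Measurable fun y => ν y A)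
    (p : ℝ) (hp : 1 ≤ p)
    :
    Modulus μ σ ν p Set.univ = 0 ↔
      ∃ f : M → ℝ≥0∞, Measurable f ∧ (∫⁻ x, f x ^ p ∂μ) < ∞ ∧
        ∀ᵐ y ∂σ, (∫⁻ x, f x ∂(ν y)) = ∞ := by
  have hp0 : 0 < p := by linarith
  constructor
  · intro h
    have hex (n : ℕ) : ∃ f : M → ℝ≥0∞, IsAdmissible μ σ ν p Set.univ f ∧
        (∫⁻ x, f x ^ p ∂μ) ^ (1 / p) < 2⁻¹ ^ n := by
      have hpos : Modulus μ σ ν p Set.univ < 2⁻¹ ^ n := by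
        rw [h]
        exact ENNReal.pow_pos (by simp) n
      simpa only [Modulus, iInf_lt_iff, exists_prop] using hpos
    choose f hadm hlt using hex
    refine ⟨fun x => ∑' n, f n x, Measurable.tsum fun n => (hadm n).1, ?_, ?_⟩
    · have hfin : (∫⁻ x, (∑' n, f n x) ^ p ∂μ) ^ (1 / p) < ∞ := by
        refine (lintegral_Lp_tsum_le hp fun n => (hadm n).1).trans_lt ?_
        refine (ENNReal.tsum_le_tsum fun n => (hlt n).le).trans_lt ?_
        rw [ENNReal.tsum_geometric, ENNReal.one_sub_inv_two, inv_inv]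
        exact ENNReal.ofNat_lt_top
      exact (ENNReal.rpow_lt_top_iff_of_pos (by positivity)).1 hfin
    · filter_upwards [ae_all_iff.2 fun n => (hadm n).2.2] with y hy
      rw [lintegral_tsum fun n => (hadm n).1.aemeasurable, ← top_le_iff]
      calc ∞ = ∑' _ : ℕ, (1 : ℝ≥0∞) := (ENNReal.tsum_const_eq_top_of_ne_zero one_ne_zero).symm
        _ ≤ _ := ENNReal.tsum_le_tsum fun n => hy n (Set.mem_univ y)
  · rintro ⟨f, hf, hfin, hinf⟩
    set A := (∫⁻ x, f x ^ p ∂μ) ^ (1 / p)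
    have hA_top : A ≠ ∞ := (ENNReal.rpow_lt_top_iff_of_pos (by positivity)).2 hfin |>.ne
    have hbound : ∀ᶠ n : ℕ in atTop, Modulus μ σ ν p Set.univ ≤ (n : ℝ≥0∞)⁻¹ * A := by
      filter_upwards [eventually_ne_atTop 0] with n hn
      have hc : ((n : ℝ≥0∞)⁻¹) ^ p ≠ ∞ :=
        ENNReal.rpow_ne_top_of_nonneg hp0.le (by simpa using hn)
      have hint : ∫⁻ x, ((n : ℝ≥0∞)⁻¹ * f x) ^ p ∂μ =
          (n : ℝ≥0∞)⁻¹ ^ p * ∫⁻ x, f x ^ p ∂μ := by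
        simp_rw [ENNReal.mul_rpow_of_nonneg _ _ hp0.le]
        exact lintegral_const_mul' _ _ hc
      have hadm : IsAdmissible μ σ ν p Set.univ (fun x => (n : ℝ≥0∞)⁻¹ * f x) := by
        refine ⟨hf.const_mul _, ?_, ?_⟩
        · rw [hint]
          exact ENNReal.mul_lt_top hc.lt_top hfin
        · filter_upwards [hinf] with y hy _
          rw [lintegral_const_mul _ hf, hy, ENNReal.mul_top (by simp)]
          exact le_top
      refine (iInf₂_le _ hadm).trans_eq ?_
      rw [hint, ENNReal.mul_rpow_of_nonneg _ _ (by positivity), ← ENNReal.rpow_mul,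
        mul_one_div_cancel hp0.ne', ENNReal.rpow_one]
    have hlim : Tendsto (fun n : ℕ => (n : ℝ≥0∞)⁻¹ * A) atTop (nhds 0) := by
      simpa using ENNReal.Tendsto.mul_const ENNReal.tendsto_inv_nat_nhds_zero (Or.inr hA_top)
    exact le_antisymm (ge_of_tendsto hlim hbound) zero_le
end

section
/- For every measurable function f : M → ℝ with ∫_M |f|^p dμ < ∞ there exists a measurable set S ⊆ N with Mod_p(S) = 0 such that ∫_M |f| dν_y < ∞ for σ-almost every y ∈ N ∖ S. -/
open MeasureTheory ENNReal Filter

variable {M N : Type*}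

/-- A set on which some `p`-integrable function has infinite integrals has zero `p`-modulus. -/
theorem modulus_eq_zero_of_lintegral_eq_top {M N : Type*} [MeasurableSpace M] [MeasurableSpace N]
    (μ : Measure M) (σ : Measure N) (ν : N → Measure M) {p : ℝ} (hp : 0 < p) {S : Set N}
    {g : M → ℝ≥0∞} (hg : Measurable g) (hgp : (∫⁻ x, g x ^ p ∂μ) < ∞)
    (hS : ∀ y ∈ S, ∫⁻ x, g x ∂(ν y) = ∞) : Modulus μ σ ν p S = 0 := by
  have hK : (∫⁻ x, g x ^ p ∂μ) ^ (1 / p) ≠ ∞ :=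
    ENNReal.rpow_ne_top_of_nonneg (by positivity) hgp.ne
  have key : ∀ c : ℝ≥0∞, c ≠ 0 → c ≠ ∞ →
      Modulus μ σ ν p S ≤ c * (∫⁻ x, g x ^ p ∂μ) ^ (1 / p) := by
    intro c hc0 hct
    have hint : (∫⁻ x, (c * g x) ^ p ∂μ) = c ^ p * ∫⁻ x, g x ^ p ∂μ := by
      simp_rw [ENNReal.mul_rpow_of_nonneg _ _ hp.le]
      exact lintegral_const_mul _ (hg.pow_const p)
    have hadm : IsAdmissible μ σ ν p S (fun x => c * g x) := by
      refine ⟨hg.const_mul c, ?_, ae_of_all _ fun y hy => ?_⟩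
      · rw [hint]
        exact ENNReal.mul_lt_top (ENNReal.rpow_lt_top_of_nonneg hp.le hct) hgp
      · rw [lintegral_const_mul _ hg, hS y hy, ENNReal.mul_top hc0]
        exact le_top
    refine (iInf₂_le _ hadm).trans_eq ?_
    rw [hint, ENNReal.mul_rpow_of_nonneg _ _ (by positivity), ← ENNReal.rpow_mul,
      mul_one_div_cancel hp.ne', ENNReal.rpow_one]
  have hlim : Tendsto (fun n : ℕ => (n : ℝ≥0∞)⁻¹ * (∫⁻ x, g x ^ p ∂μ) ^ (1 / p)) atTop
      (nhds 0) := by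
    simpa using ENNReal.Tendsto.mul_const ENNReal.tendsto_inv_nat_nhds_zero (Or.inr hK)
  refine le_antisymm (ge_of_tendsto hlim ?_) zero_le
  filter_upwards [eventually_gt_atTop 0] with n hn
  exact key _ (by simp) (by simp [hn.ne'])

theorem statement_4
    {M N : Type*} [MeasurableSpace M] [MeasurableSpace N]
    (μ : Measure M) (σ : Measure N) [SigmaFinite μ] [SigmaFinite σ]
    (ν : N → Measure M) (hνsf : ∀ y, SigmaFinite (ν y))
    (hker : ∀ A : Set M, MeasurableSet A → Measurable fun y => ν y A)
    (p : ℝ) (hp : 1 ≤ p)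
    (f : M → ℝ) (hf : Measurable f)
    (hfp : (∫⁻ x, ENNReal.ofReal |f x| ^ p ∂μ) < ∞) :
    ∃ S : Set N, MeasurableSet S ∧ Modulus μ σ ν p S = 0 ∧
      ∀ᵐ y ∂σ, y ∉ S → (∫⁻ x, ENNReal.ofReal |f x| ∂(ν y)) < ∞ := by
  have hg : Measurable fun x => ENNReal.ofReal |f x| := (measurable_norm.comp hf).ennreal_ofReal
  have hν : Measurable ν := Measure.measurable_of_measurable_coe ν hker
  refine ⟨{y | ∫⁻ x, ENNReal.ofReal |f x| ∂(ν y) = ∞},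
    ((Measure.measurable_lintegral hg).comp hν) (measurableSet_singleton ∞),
    modulus_eq_zero_of_lintegral_eq_top μ σ ν (by linarith) hg hfp fun _ hy => hy,
    ae_of_all _ fun _ hy => lt_top_iff_ne_top.2 hy⟩
end

section
/- (Fuglede's lemma.) If f_n, f : M → ℝ are measurable, p-integrable with respect to μ, and ∫_M |f_n − f|^p dμ → 0 as n → ∞, then there exist a subsequence (f_{n_i}) and a measurable set S ⊆ N with Mod_p(S) = 0 such that for σ-almost every y ∈ N ∖ S one has ∫_M |f_{n_i} − f| dν_y → 0 as i → ∞. -/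
open MeasureTheory ENNReal Filter

variable {M N : Type*}

/-- The set of `y` with `∫ h dν_y = ∞` has vanishing `p`-modulus when `h` is `p`-integrable. -/
theorem Modulus.lintegral_eq_top_eq_zero [MeasurableSpace M] [MeasurableSpace N]
    (μ : Measure M) (σ : Measure N) (ν : N → Measure M) {p : ℝ} (hp : 0 < p)
    {h : M → ℝ≥0∞} (hm : Measurable h) (hfin : (∫⁻ x, h x ^ p ∂μ) < ∞) :
    Modulus μ σ ν p {y | ∫⁻ x, h x ∂(ν y) = ∞} = 0 := by
  set K : ℝ≥0∞ := (∫⁻ x, h x ^ p ∂μ) ^ (1 / p)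
  have hK : K ≠ ∞ := (ENNReal.rpow_lt_top_of_nonneg (by positivity) hfin.ne).ne
  have bound : ∀ n : ℕ, 0 < n →
      Modulus μ σ ν p {y | ∫⁻ x, h x ∂(ν y) = ∞} ≤ (n : ℝ≥0∞)⁻¹ * K := by
    intro n hn
    have hc0 : (n : ℝ≥0∞)⁻¹ ≠ 0 := by simp
    have hct : (n : ℝ≥0∞)⁻¹ ≠ ∞ := by simp; omega
    have hpow : ∫⁻ x, ((n : ℝ≥0∞)⁻¹ * h x) ^ p ∂μ
        = ((n : ℝ≥0∞)⁻¹) ^ p * ∫⁻ x, h x ^ p ∂μ := by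
      simp_rw [ENNReal.mul_rpow_of_nonneg _ _ hp.le]
      exact lintegral_const_mul _ (hm.pow_const p)
    refine iInf₂_le_of_le (fun x => (n : ℝ≥0∞)⁻¹ * h x) ⟨hm.const_mul _, ?_, ?_⟩ ?_
    · rw [hpow]
      exact ENNReal.mul_lt_top (ENNReal.rpow_lt_top_of_nonneg hp.le hct) hfin
    · refine Eventually.of_forall fun y hy => ?_
      rw [lintegral_const_mul _ hm, show ∫⁻ x, h x ∂(ν y) = ∞ from hy, ENNReal.mul_top hc0]
      exact le_top
    · rw [hpow, ENNReal.mul_rpow_of_nonneg _ _ (by positivity), ← ENNReal.rpow_mul,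
        mul_one_div_cancel hp.ne', ENNReal.rpow_one]
  have lim : Tendsto (fun n : ℕ => (n : ℝ≥0∞)⁻¹ * K) atTop (nhds 0) := by
    simpa using ENNReal.Tendsto.mul_const ENNReal.tendsto_inv_nat_nhds_zero (Or.inr hK)
  exact le_antisymm (ge_of_tendsto lim ((eventually_gt_atTop 0).mono bound)) zero_le

theorem statement_5
    {M N : Type*} [MeasurableSpace M] [MeasurableSpace N]
    (μ : Measure M) (σ : Measure N) [SigmaFinite μ] [SigmaFinite σ]
    (ν : N → Measure M) (hνsf : ∀ y, SigmaFinite (ν y))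
    (hker : ∀ A : Set M, MeasurableSet A → Measurable fun y => ν y A)
    (p : ℝ) (hp : 1 ≤ p)
    (f : ℕ → M → ℝ) (g : M → ℝ) (hf : ∀ n, Measurable (f n)) (hg : Measurable g)
    (hfp : ∀ n, (∫⁻ x, ENNReal.ofReal |f n x| ^ p ∂μ) < ∞)
    (hgp : (∫⁻ x, ENNReal.ofReal |g x| ^ p ∂μ) < ∞)
    (hconv : Tendsto (fun n => ∫⁻ x, ENNReal.ofReal |f n x - g x| ^ p ∂μ) atTop (nhds 0)) :
    ∃ φ : ℕ → ℕ, StrictMono φ ∧ ∃ S : Set N, MeasurableSet S ∧ Modulus μ σ ν p S = 0 ∧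
      ∀ᵐ y ∂σ, y ∉ S →
        Tendsto (fun i => ∫⁻ x, ENNReal.ofReal |f (φ i) x - g x| ∂(ν y)) atTop (nhds 0) := by
  have hp0 : 0 < p := by linarith
  let u : ℕ → M → ℝ≥0∞ := fun n x => ENNReal.ofReal |f n x - g x|
  have hu : ∀ n, Measurable (u n) := fun n =>
    (measurable_norm.comp ((hf n).sub hg)).ennreal_ofReal
  have hpowt : ∀ i : ℕ, ((2 : ℝ≥0∞) ^ i) ^ p ≠ ∞ := fun i =>
    (ENNReal.rpow_lt_top_of_nonneg hp0.le (by simp)).ne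
  obtain ⟨φ, hφ, hsmall⟩ : ∃ φ : ℕ → ℕ, StrictMono φ ∧
      ∀ i, ((2 : ℝ≥0∞) ^ i) ^ p * ∫⁻ x, u (φ i) x ^ p ∂μ ≤ 2⁻¹ ^ i := by
    refine extraction_forall_of_eventually
      (P := fun i k => ((2 : ℝ≥0∞) ^ i) ^ p * ∫⁻ x, u k x ^ p ∂μ ≤ 2⁻¹ ^ i) fun i => ?_
    have lim := ENNReal.Tendsto.const_mul (a := ((2 : ℝ≥0∞) ^ i) ^ p) hconv (Or.inr (hpowt i))
    rw [mul_zero] at lim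
    exact lim.eventually_le_const (ENNReal.pow_pos (by simp) i)
  let H : M → ℝ≥0∞ := fun x => (∑' i : ℕ, (2 ^ i * u (φ i) x) ^ p) ^ (1 / p)
  have hterm : ∀ i, Measurable fun x => (2 ^ i * u (φ i) x) ^ p := fun i =>
    ((hu (φ i)).const_mul _).pow_const p
  have hH : Measurable H := (Measurable.tsum hterm).pow_const _
  have hHfin : (∫⁻ x, H x ^ p ∂μ) < ∞ := by
    calc ∫⁻ x, H x ^ p ∂μ = ∫⁻ x, ∑' i : ℕ, (2 ^ i * u (φ i) x) ^ p ∂μ := by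
          simp only [H, ← ENNReal.rpow_mul, one_div_mul_cancel hp0.ne', ENNReal.rpow_one]
      _ = ∑' i : ℕ, ((2 : ℝ≥0∞) ^ i) ^ p * ∫⁻ x, u (φ i) x ^ p ∂μ := by
          rw [lintegral_tsum fun i => (hterm i).aemeasurable]
          refine tsum_congr fun i => ?_
          simp_rw [ENNReal.mul_rpow_of_nonneg _ _ hp0.le]
          exact lintegral_const_mul _ ((hu (φ i)).pow_const p)
      _ ≤ ∑' i : ℕ, (2⁻¹ : ℝ≥0∞) ^ i := ENNReal.tsum_le_tsum hsmall
      _ < ∞ := by simp [ENNReal.tsum_geometric]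
  have hle : ∀ i x, u (φ i) x ≤ 2⁻¹ ^ i * H x := by
    intro i x
    have key : 2 ^ i * u (φ i) x ≤ H x := by
      simp only [H]
      rw [one_div, ENNReal.le_rpow_inv_iff hp0]
      exact ENNReal.le_tsum (f := fun i : ℕ => (2 ^ i * u (φ i) x) ^ p) i
    rw [← ENNReal.inv_pow, mul_comm, ← div_eq_mul_inv,
      ENNReal.le_div_iff_mul_le (by simp) (by simp), mul_comm]
    exact key
  have hνm : Measurable ν := Measure.measurable_of_measurable_coe ν hker
  refine ⟨φ, hφ, {y | ∫⁻ x, H x ∂(ν y) = ∞},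
    ((Measure.measurable_lintegral hH).comp hνm) (measurableSet_singleton ∞),
    Modulus.lintegral_eq_top_eq_zero μ σ ν hp0 hH hHfin, Eventually.of_forall fun y hy => ?_⟩
  have lim : Tendsto (fun i : ℕ => (2⁻¹ : ℝ≥0∞) ^ i * ∫⁻ x, H x ∂(ν y)) atTop (nhds 0) := by
    simpa using ENNReal.Tendsto.mul_const
      (ENNReal.tendsto_pow_atTop_nhds_zero_of_lt_one (r := 2⁻¹) (by simp)) (Or.inr hy)
  refine tendsto_of_tendsto_of_tendsto_of_le_of_le tendsto_const_nhds lim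
    (fun _ => zero_le) fun i => ?_
  exact (lintegral_mono (hle i)).trans_eq (lintegral_const_mul _ hH)
end

section
/- If there exists an extremal function f₀ for the p-modulus, then for every measurable set S ⊆ N with μ(π⁻¹(S)) > 0 one has Mod_p(S) > 0. -/
open MeasureTheory ENNReal Filter

variable {M N : Type*}

theorem ae_eq_of_measure_diff_fiber_eq_zero [MeasurableSpace M] {m : Measure M} {π : M → N}
    {y : N} (h : m (Set.univ \ π ⁻¹' {y}) = 0) : ∀ᵐ x ∂m, π x = y := by
  rw [ae_iff]
  convert h using 2
  ext x
  simp

open scoped Classical in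
/-- Replacing `f₀` by `f` over `S` turns a function admissible for `N` and one admissible for `S`
into a function admissible for `N`. -/
theorem IsAdmissible.piecewise [MeasurableSpace M] [MeasurableSpace N]
    {μ : Measure M} {σ : Measure N} {ν : N → Measure M} {p : ℝ}
    {π : M → N} (hπ : Measurable π)
    (hleaf : ∀ᵐ y ∂σ, ν y (Set.univ \ π ⁻¹' {y}) = 0)
    {S : Set N} (hS : MeasurableSet S) {f f₀ : M → ℝ≥0∞}
    (hf : IsAdmissible μ σ ν p S f) (hf₀ : IsAdmissible μ σ ν p Set.univ f₀) :
    IsAdmissible μ σ ν p Set.univ ((π ⁻¹' S).piecewise f f₀) := by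
  refine ⟨hf.1.piecewise (hπ hS) hf₀.1, ?_, ?_⟩
  · refine lt_of_le_of_lt ?_ (ENNReal.add_lt_top.2 ⟨hf.2.1, hf₀.2.1⟩)
    rw [← lintegral_add_left (hf.1.pow_const p)]
    refine lintegral_mono fun x => ?_
    by_cases hx : x ∈ π ⁻¹' S <;> simp [hx]
  · filter_upwards [hleaf, hf.2.2, hf₀.2.2] with y hy h h₀ _
    have hae := ae_eq_of_measure_diff_fiber_eq_zero hy
    by_cases hyS : y ∈ S
    · refine (h hyS).trans_eq (lintegral_congr_ae ?_)
      filter_upwards [hae] with x hx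
      simp [hx, hyS]
    · refine (h₀ trivial).trans_eq (lintegral_congr_ae ?_)
      filter_upwards [hae] with x hx
      simp [hx, hyS]

/-- The `p`-energy over `S` of an extremal function is a lower bound for the modulus of `S`. -/
theorem IsExtremal.setLIntegral_rpow_le_modulus [MeasurableSpace M] [MeasurableSpace N]
    {μ : Measure M} {σ : Measure N} {ν : N → Measure M} {p : ℝ} (hp : 0 < p)
    {π : M → N} (hπ : Measurable π)
    (hleaf : ∀ᵐ y ∂σ, ν y (Set.univ \ π ⁻¹' {y}) = 0)
    {S : Set N} (hS : MeasurableSet S) {f₀ : M → ℝ≥0∞} (hf₀ : IsExtremal μ σ ν p f₀) :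
    (∫⁻ x in π ⁻¹' S, f₀ x ^ p ∂μ) ^ (1 / p) ≤ Modulus μ σ ν p S := by
  classical
  refine le_iInf₂ fun f hf => ?_
  refine ENNReal.rpow_le_rpow ?_ (by positivity)
  have hP : MeasurableSet (π ⁻¹' S) := hπ hS
  have hle : (∫⁻ x, f₀ x ^ p ∂μ) ≤ ∫⁻ x, (π ⁻¹' S).piecewise f f₀ x ^ p ∂μ := by
    rw [← ENNReal.rpow_le_rpow_iff (z := 1 / p) (by positivity), hf₀.2]
    exact iInf₂_le _ (hf.piecewise hπ hleaf hS hf₀.1)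
  rw [← lintegral_add_compl (fun x => f₀ x ^ p) hP,
    ← lintegral_add_compl (fun x => (π ⁻¹' S).piecewise f f₀ x ^ p) hP,
    setLIntegral_congr_fun (f := fun x => (π ⁻¹' S).piecewise f f₀ x ^ p)
      (g := fun x => f x ^ p) hP (fun x hx => by simp_all),
    setLIntegral_congr_fun (f := fun x => (π ⁻¹' S).piecewise f f₀ x ^ p)
      (g := fun x => f₀ x ^ p) hP.compl (fun x hx => by simp_all)] at hle
  have hfin : (∫⁻ x in (π ⁻¹' S)ᶜ, f₀ x ^ p ∂μ) ≠ ∞ :=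
    ((setLIntegral_le_lintegral _ _).trans_lt hf₀.1.2.1).ne
  exact ((ENNReal.add_le_add_iff_right hfin).1 hle).trans (setLIntegral_le_lintegral _ _)

/-- If a function vanishes `μ`-almost everywhere on a measurable set, then its restriction to that
set vanishes `ν y`-almost everywhere, for `σ`-almost every `y`. -/
theorem ae_ae_eq_zero_of_disintegration [MeasurableSpace M] [MeasurableSpace N]
    {μ : Measure M} {σ : Measure N} {ν : N → Measure M}
    (hker : ∀ A : Set M, MeasurableSet A → Measurable fun y => ν y A)
    {J : M → ℝ≥0∞} (hJ : Measurable J) (hJtop : ∀ x, J x < ∞)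
    (hFubini : ∀ f : M → ℝ≥0∞, Measurable f →
      ∫⁻ x, f x ∂μ = ∫⁻ y, (∫⁻ x, f x / J x ∂(ν y)) ∂σ)
    {g : M → ℝ≥0∞} (hg : Measurable g) (h : ∫⁻ x, g x ∂μ = 0) :
    ∀ᵐ y ∂σ, ∀ᵐ x ∂(ν y), g x = 0 := by
  have hgJ : Measurable fun x => g x / J x := hg.div hJ
  have hν : Measurable ν := Measure.measurable_of_measurable_coe _ hker
  rw [hFubini g hg] at h
  filter_upwards [(lintegral_eq_zero_iff ((Measure.measurable_lintegral hgJ).comp hν)).1 h]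
    with y hy
  filter_upwards [(lintegral_eq_zero_iff hgJ).1 hy] with x hx
  simpa [ENNReal.div_eq_zero_iff, (hJtop x).ne] using hx

theorem statement_6
    {M N : Type*} [MeasurableSpace M] [MeasurableSpace N]
    (μ : Measure M) (σ : Measure N) [SigmaFinite μ] [SigmaFinite σ]
    (ν : N → Measure M) (hνsf : ∀ y, SigmaFinite (ν y))
    (hker : ∀ A : Set M, MeasurableSet A → Measurable fun y => ν y A)
    (p : ℝ) (hp : 1 ≤ p)
    (π : M → N) (hπ : Measurable π)
    (hleaf : ∀ᵐ y ∂σ, ν y (Set.univ \ π ⁻¹' {y}) = 0)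
    (J : M → ℝ≥0∞) (hJ : Measurable J) (hJ0 : ∀ x, 0 < J x) (hJtop : ∀ x, J x < ∞)
    (hFubini : ∀ f : M → ℝ≥0∞, Measurable f →
      ∫⁻ x, f x ∂μ = ∫⁻ y, (∫⁻ x, f x / J x ∂(ν y)) ∂σ)
    (f₀ : M → ℝ≥0∞) (hf₀ : IsExtremal μ σ ν p f₀)
    (S : Set N) (hS : MeasurableSet S) (hpos : 0 < μ (π ⁻¹' S)) :
    0 < Modulus μ σ ν p S := by
  have hp0 : 0 < p := by linarith
  have hP : MeasurableSet (π ⁻¹' S) := hπ hS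
  refine lt_of_lt_of_le ?_ (hf₀.setLIntegral_rpow_le_modulus hp0 hπ hleaf hS)
  rw [pos_iff_ne_zero]
  intro h0
  rw [ENNReal.rpow_eq_zero_iff_of_pos (by positivity), ← lintegral_indicator hP] at h0
  have hzero := ae_ae_eq_zero_of_disintegration hker hJ hJtop hFubini
    ((hf₀.1.1.pow_const p).indicator hP) h0
  refine hpos.ne' ?_
  rw [← lintegral_indicator_one hP, hFubini _ (measurable_one.indicator hP),
    ← lintegral_zero (μ := σ)]
  refine lintegral_congr_ae ?_
  filter_upwards [hleaf, hf₀.1.2.2, hzero] with y hy h₁ hz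
  have hae := ae_eq_of_measure_diff_fiber_eq_zero hy
  by_cases hyS : y ∈ S
  · have hf₀zero : ∫⁻ x, f₀ x ∂(ν y) = 0 := by
      rw [← lintegral_zero (μ := ν y)]
      refine lintegral_congr_ae ?_
      filter_upwards [hae, hz] with x hx hzx
      simpa [Set.indicator, hx, hyS, hp0, hp0.not_gt] using hzx
    simpa [hf₀zero] using h₁ trivial
  · rw [← lintegral_zero (μ := ν y)]
    refine lintegral_congr_ae ?_
    filter_upwards [hae] with x hx
    simp [Set.indicator, hx, hyS]
end

section
/- Assume 1 < p < ∞ and Mod_p(N) < ∞ (i.e. at least one p-admissible function for N exists). If every measurable set S ⊆ N with μ(π⁻¹(S)) > 0 satisfies Mod_p(S) > 0, then there exists an extremal function f₀ for the p-modulus, i.e. f₀ is p-admissible for N and (∫_M f₀^p dμ)^{1/p} = Mod_p(N). -/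
open MeasureTheory ENNReal Filter

variable {M N : Type*}

section LeafNormalization

variable [MeasurableSpace M]
  {ν : N → Measure M} {π : M → N} {p : ℝ} {J : M → ℝ≥0∞}

/-- The function `φ` rescaled on each leaf to have leaf integral one. -/
noncomputable def leafNormalize (ν : N → Measure M) (π : M → N) (φ : M → ℝ≥0∞) (x : M) : ℝ≥0∞ :=
  φ x / ∫⁻ z, φ z ∂(ν (π x))

lemma measurable_lintegral_leaf [MeasurableSpace N]
    (hker : ∀ A : Set M, MeasurableSet A → Measurable fun y => ν y A)
    {f : M → ℝ≥0∞} (hf : Measurable f) : Measurable fun y => ∫⁻ x, f x ∂(ν y) :=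
  (Measure.measurable_lintegral hf).comp (Measure.measurable_of_measurable_coe ν hker)

lemma ae_leaf_eq {y : N} (hy : ν y (Set.univ \ π ⁻¹' {y}) = 0) : ∀ᵐ x ∂(ν y), π x = y := by
  rw [ae_iff]
  convert hy using 2
  ext x
  simp

lemma measurable_leafNormalize [MeasurableSpace N]
    (hker : ∀ A : Set M, MeasurableSet A → Measurable fun y => ν y A) (hπ : Measurable π)
    {φ : M → ℝ≥0∞} (hφ : Measurable φ) : Measurable (leafNormalize ν π φ) :=
  hφ.div ((measurable_lintegral_leaf hker hφ).comp hπ)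

lemma lintegral_leafNormalize {φ : M → ℝ≥0∞} (hφ : Measurable φ) {y : N}
    (hy : ∀ᵐ x ∂(ν y), π x = y) (h0 : ∫⁻ x, φ x ∂(ν y) ≠ 0) (htop : ∫⁻ x, φ x ∂(ν y) ≠ ∞) :
    ∫⁻ x, leafNormalize ν π φ x ∂(ν y) = 1 := by
  have : ∫⁻ x, leafNormalize ν π φ x ∂(ν y) = ∫⁻ x, φ x * (∫⁻ z, φ z ∂(ν y))⁻¹ ∂(ν y) := by
    refine lintegral_congr_ae ?_
    filter_upwards [hy] with x hx
    rw [leafNormalize, hx, div_eq_mul_inv]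
  rw [this, lintegral_mul_const _ hφ, ENNReal.mul_inv_cancel h0 htop]

lemma rpow_conj_div_self (hp : 1 < p) {j : ℝ≥0∞} (h0 : 0 < j) (htop : j < ∞) :
    (j ^ (1 / (p - 1))) ^ p / j = j ^ (1 / (p - 1)) := by
  have hp' : p - 1 ≠ 0 := by linarith
  rw [← ENNReal.rpow_mul, show (1 / (p - 1)) * p = 1 / (p - 1) + 1 by field_simp; ring,
    ENNReal.rpow_add _ _ h0.ne' htop.ne, ENNReal.rpow_one, ENNReal.mul_div_cancel_right h0.ne' htop.ne]

lemma lintegral_leafNormalize_rpow_div (hp : 1 < p) {φ : M → ℝ≥0∞} (hφ : Measurable φ)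
    (hφJ : ∀ x, φ x ^ p / J x = φ x) {y : N} (hy : ∀ᵐ x ∂(ν y), π x = y)
    (h0 : ∫⁻ x, φ x ∂(ν y) ≠ 0) (htop : ∫⁻ x, φ x ∂(ν y) ≠ ∞) :
    ∫⁻ x, leafNormalize ν π φ x ^ p / J x ∂(ν y) = (∫⁻ x, φ x ∂(ν y)) ^ (1 - p) := by
  have : ∫⁻ x, leafNormalize ν π φ x ^ p / J x ∂(ν y) =
      ∫⁻ x, φ x * (∫⁻ z, φ z ∂(ν y)) ^ (-p) ∂(ν y) := by
    refine lintegral_congr_ae ?_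
    filter_upwards [hy] with x hx
    rw [leafNormalize, hx, ENNReal.div_rpow_of_nonneg _ _ (by linarith), ENNReal.rpow_neg]
    nth_rw 2 [← hφJ x]
    simp only [div_eq_mul_inv]
    ring
  rw [this, lintegral_mul_const _ hφ, sub_eq_add_neg, ENNReal.rpow_add _ _ h0 htop,
    ENNReal.rpow_one]

lemma lintegral_leafNormalize_rpow_div_eq_zero (hp : 1 < p) {φ : M → ℝ≥0∞} (hφ : Measurable φ)
    {y : N} (h0 : ∫⁻ x, φ x ∂(ν y) = 0) :
    ∫⁻ x, leafNormalize ν π φ x ^ p / J x ∂(ν y) = 0 := by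
  have hz := (lintegral_eq_zero_iff hφ).1 h0
  rw [← lintegral_zero (μ := ν y)]
  refine lintegral_congr_ae ?_
  filter_upwards [hz] with x hx
  rw [leafNormalize, hx]
  simp [show 0 < p by linarith]

/-- Hölder's inequality on a leaf: the lower bound for the leaf energy. -/
lemma lintegral_rpow_le_of_one_le_lintegral (hp : 1 < p) (hJ : Measurable J) (hJ0 : ∀ x, 0 < J x)
    (hJtop : ∀ x, J x < ∞) {m : Measure M} {f : M → ℝ≥0∞} (hf : Measurable f)
    (h1 : 1 ≤ ∫⁻ x, f x ∂m) (htop : ∫⁻ x, J x ^ (1 / (p - 1)) ∂m ≠ ∞) :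
    (∫⁻ x, J x ^ (1 / (p - 1)) ∂m) ^ (1 - p) ≤ ∫⁻ x, f x ^ p / J x ∂m := by
  have hp0 : 0 < p := by linarith
  have hp1 : 0 < p - 1 := by linarith
  have hpq : p.HolderConjugate (p / (p - 1)) := Real.HolderConjugate.conjExponent hp
  have hH := ENNReal.lintegral_mul_le_Lp_mul_Lq m hpq
    (f := fun x => f x * (J x ^ (1 / p))⁻¹) (g := fun x => J x ^ (1 / p))
    (hf.mul (hJ.pow_const _).inv).aemeasurable (hJ.pow_const _).aemeasurable
  have e1 : ∀ x, f x * (J x ^ (1 / p))⁻¹ * J x ^ (1 / p) = f x := fun x => by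
    rw [mul_assoc, ENNReal.inv_mul_cancel, mul_one]
    · exact (ENNReal.rpow_pos (hJ0 x) (hJtop x).ne).ne'
    · exact ENNReal.rpow_ne_top_of_nonneg (by positivity) (hJtop x).ne
  have e2 : ∀ x, (f x * (J x ^ (1 / p))⁻¹) ^ p = f x ^ p / J x := fun x => by
    rw [ENNReal.mul_rpow_of_nonneg _ _ hp0.le, ENNReal.inv_rpow, ← ENNReal.rpow_mul,
      one_div_mul_cancel hp0.ne', ENNReal.rpow_one, div_eq_mul_inv]
  have e3 : ∀ x, (J x ^ (1 / p)) ^ (p / (p - 1)) = J x ^ (1 / (p - 1)) := fun x => by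
    rw [← ENNReal.rpow_mul]
    congr 1
    field_simp
  simp only [Pi.mul_apply, e1, e2, e3] at hH
  set I := ∫⁻ x, J x ^ (1 / (p - 1)) ∂m
  set E := ∫⁻ x, f x ^ p / J x ∂m
  have h2 : 1 ≤ E * I ^ (p - 1) := by
    have h3 := ENNReal.rpow_le_rpow (h1.trans hH) hp0.le
    rwa [ENNReal.one_rpow, ENNReal.mul_rpow_of_nonneg _ _ hp0.le, ← ENNReal.rpow_mul,
      ← ENNReal.rpow_mul, one_div_mul_cancel hp0.ne', ENNReal.rpow_one,
      show 1 / (p / (p - 1)) * p = p - 1 by field_simp] at h3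
  rw [show 1 - p = -(p - 1) by ring, ENNReal.rpow_neg]
  exact ENNReal.inv_le_iff_le_mul (fun _ h => by simp [h] at h2)
    (fun h => absurd h (ENNReal.rpow_ne_top_of_nonneg hp1.le htop)) |>.2 (by rwa [mul_comm])

/-- If no set of leaves of positive measure has zero modulus, then almost every leaf has finite
total weight `∫ J^{1/(p-1)} dν_y`. -/
lemma ae_lintegral_rpow_ne_top [MeasurableSpace N]
    {μ : Measure M} {σ : Measure N} [SigmaFinite μ] [SigmaFinite σ]
    (hker : ∀ A : Set M, MeasurableSet A → Measurable fun y => ν y A)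
    (hp : 1 < p) (hπ : Measurable π) (hleaf : ∀ᵐ y ∂σ, ∀ᵐ x ∂(ν y), π x = y)
    (hJ : Measurable J) (hJ0 : ∀ x, 0 < J x) (hJtop : ∀ x, J x < ∞)
    (hFubini : ∀ f : M → ℝ≥0∞, Measurable f →
      ∫⁻ x, f x ∂μ = ∫⁻ y, (∫⁻ x, f x / J x ∂(ν y)) ∂σ)
    (hpos : ∀ S : Set N, MeasurableSet S → 0 < μ (π ⁻¹' S) → 0 < Modulus μ σ ν p S) :
    ∀ᵐ y ∂σ, ∫⁻ x, J x ^ (1 / (p - 1)) ∂(ν y) ≠ ∞ := by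
  have hp1 : 0 < p - 1 := by linarith
  have hp0 : 0 < p := by linarith
  set w : M → ℝ≥0∞ := fun x => J x ^ (1 / (p - 1)) with hw
  have hwm : Measurable w := hJ.pow_const _
  set S : Set N := {y | ∫⁻ x, w x ∂(ν y) = ∞} with hS
  have hSm : MeasurableSet S := measurable_lintegral_leaf hker hwm (measurableSet_singleton _)
  by_contra hne
  have hσS : σ S ≠ 0 := by simpa [ae_iff] using hne
  have hμS : 0 < μ (π ⁻¹' S) := by
    rw [pos_iff_ne_zero]
    intro hzero
    have hm : Measurable fun x => (π ⁻¹' S).indicator (1 : M → ℝ≥0∞) x / J x :=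
      (measurable_one.indicator (hπ hSm)).div hJ
    have h := hFubini _ (measurable_one.indicator (hπ hSm))
    rw [lintegral_indicator_one (hπ hSm), hzero, eq_comm,
      lintegral_eq_zero_iff (measurable_lintegral_leaf hker hm)] at h
    refine hσS (measure_mono_null (t := {y | ¬ (y ∉ S)}) (fun y hy => by simpa using hy)
      (ae_iff.1 ?_))
    filter_upwards [h, hleaf] with y hy hl hyS
    rw [Pi.zero_apply, lintegral_eq_zero_iff hm] at hy
    have hw0 : ∫⁻ x, w x ∂(ν y) = 0 := by
      rw [← lintegral_zero (μ := ν y)]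
      refine lintegral_congr_ae ?_
      filter_upwards [hy, hl] with x hx hxl
      simp [Set.indicator, hxl, hyS, (hJtop x).ne] at hx
    rw [hS, Set.mem_ofPred_eq, hw0] at hyS
    exact ENNReal.zero_ne_top hyS
  have hMod := hpos S hSm hμS
  obtain ⟨h, hh0, hhm, hhint⟩ := exists_pos_lintegral_lt_of_sigmaFinite σ
    (ε := Modulus μ σ ν p S ^ p) (by simp [hMod.ne', hp0, hp0.not_gt])
  -- an exhaustion of `M` by sets whose leafwise weight is almost everywhere finite
  set A : ℕ → Set M := fun n => spanningSets μ n ∩ {x | J x ≤ n} with hA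
  have hAm : ∀ n, MeasurableSet (A n) := fun n =>
    (measurableSet_spanningSets μ n).inter (measurableSet_le hJ measurable_const)
  have hAmono : Monotone A := fun m n hmn x hx =>
    ⟨monotone_spanningSets μ hmn hx.1, le_trans (Set.mem_ofPred_eq ▸ hx.2) (Nat.cast_le.2 hmn)⟩
  have hAex : ∀ x, ∃ n, x ∈ A n := fun x => by
    obtain ⟨k, hk⟩ := ENNReal.exists_nat_gt (hJtop x).ne
    refine ⟨max k (spanningSetsIndex μ x), ?_, hk.le.trans (by exact_mod_cast le_max_left _ _)⟩
    exact monotone_spanningSets μ (le_max_right _ _) (mem_spanningSetsIndex μ x)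
  set I : ℕ → N → ℝ≥0∞ := fun n y => ∫⁻ x, (A n).indicator w x ∂(ν y) with hI
  have hIm : ∀ n, Measurable (I n) := fun n =>
    measurable_lintegral_leaf hker (hwm.indicator (hAm n))
  have hIfin : ∀ᵐ y ∂σ, ∀ n, I n y < ∞ := by
    rw [ae_all_iff]
    intro n
    have hm : Measurable fun x => (A n).indicator (1 : M → ℝ≥0∞) x / J x :=
      (measurable_one.indicator (hAm n)).div hJ
    have hfinite : ∫⁻ y, (∫⁻ x, (A n).indicator 1 x / J x ∂(ν y)) ∂σ ≠ ∞ := by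
      rw [← hFubini _ (measurable_one.indicator (hAm n)), lintegral_indicator_one (hAm n)]
      exact ((measure_mono Set.inter_subset_left).trans_lt (measure_spanningSets_lt_top μ n)).ne
    filter_upwards [ae_lt_top (measurable_lintegral_leaf hker hm) hfinite] with y hy
    have hc : ((n : ℝ≥0∞) ^ (1 / (p - 1) + 1)) ≠ ∞ :=
      ENNReal.rpow_ne_top_of_nonneg (by positivity) (ENNReal.natCast_ne_top n)
    refine lt_of_le_of_lt ?_ (ENNReal.mul_lt_top hc.lt_top hy)
    rw [← lintegral_const_mul _ hm]
    refine lintegral_mono fun x => ?_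
    by_cases hx : x ∈ A n
    · simp only [Set.indicator_of_mem hx, Pi.one_apply, hw]
      rw [one_div (J x), ← div_eq_mul_inv, ENNReal.le_div_iff_mul_le (.inl (hJ0 x).ne')
        (.inl (hJtop x).ne)]
      nth_rw 2 [← ENNReal.rpow_one (J x)]
      rw [← ENNReal.rpow_add _ _ (hJ0 x).ne' (hJtop x).ne]
      exact ENNReal.rpow_le_rpow hx.2 (by positivity)
    · simp [Set.indicator_of_notMem hx]
  have hex : ∀ y, ∃ n, y ∉ S ∨ I n y ^ (1 - p) ≤ h y := by
    intro y
    by_cases hy : y ∈ S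
    swap
    · exact ⟨0, .inl hy⟩
    have hsup : ⨆ n, I n y = ∞ := by
      rw [← lintegral_iSup (fun n => hwm.indicator (hAm n))
        (fun m n hmn => Set.indicator_le_indicator_of_subset (hAmono hmn) (fun _ => zero_le))]
      rw [← (show ∫⁻ x, w x ∂(ν y) = ∞ from hy)]
      refine lintegral_congr fun x => le_antisymm
        (iSup_le fun n => Set.indicator_le_self' (fun _ _ => zero_le) x) ?_
      obtain ⟨n, hn⟩ := hAex x
      exact le_iSup_of_le n (by rw [Set.indicator_of_mem hn])
    have hlt : ((h y : ℝ≥0∞)⁻¹) ^ (p - 1)⁻¹ < ⨆ n, I n y := by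
      rw [hsup]
      exact (ENNReal.rpow_ne_top_of_nonneg (by positivity)
        (ENNReal.inv_ne_top.2 (by exact_mod_cast (hh0 y).ne'))).lt_top
    obtain ⟨n, hn⟩ := lt_iSup_iff.1 hlt
    refine ⟨n, .inr ?_⟩
    rw [show 1 - p = -(p - 1) by ring, ENNReal.rpow_neg, ENNReal.inv_le_iff_inv_le]
    exact (ENNReal.rpow_inv_le_iff hp1).1 hn.le
  classical
  set k : N → ℕ := fun y => Nat.find (hex y) with hk
  have hkm : Measurable k := measurable_find hex fun n =>
    hSm.compl.union (measurableSet_le ((hIm n).pow_const _) hhm.coe_nnreal_ennreal)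
  set B : Set M := {x | π x ∈ S ∧ x ∈ A (k (π x))} with hB
  have hBm : MeasurableSet B := by
    have : B = π ⁻¹' S ∩ ⋃ n, (k ∘ π) ⁻¹' {n} ∩ A n := by
      ext x
      simp [hB]
    rw [this]
    exact (hπ hSm).inter (.iUnion fun n =>
      ((hkm.comp hπ) (measurableSet_singleton n)).inter (hAm n))
  set φ := B.indicator w with hφ
  have hφm : Measurable φ := hwm.indicator hBm
  have hφJ : ∀ x, φ x ^ p / J x = φ x := fun x => by
    by_cases hx : x ∈ B
    · simp only [hφ, Set.indicator_of_mem hx]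
      exact rpow_conj_div_self hp (hJ0 x) (hJtop x)
    · simp [hφ, Set.indicator_of_notMem hx, hp0]
  have hφS : ∀ y ∈ S, (∀ᵐ x ∂(ν y), π x = y) → ∫⁻ x, φ x ∂(ν y) = I (k y) y := fun y hy hl => by
    refine lintegral_congr_ae ?_
    filter_upwards [hl] with x hx
    simp [hφ, hB, Set.indicator, hx, hy]
  have hφSc : ∀ y ∉ S, (∀ᵐ x ∂(ν y), π x = y) → ∫⁻ x, φ x ∂(ν y) = 0 := fun y hy hl => by
    rw [← lintegral_zero (μ := ν y)]
    refine lintegral_congr_ae ?_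
    filter_upwards [hl] with x hx
    simp [hφ, hB, hx, hy]
  have hkS : ∀ y ∈ S, I (k y) y ^ (1 - p) ≤ h y := fun y hy =>
    (Nat.find_spec (hex y)).resolve_left (not_not.2 hy)
  have hI0 : ∀ y ∈ S, I (k y) y ≠ 0 := fun y hy h0 => by
    have := hkS y hy
    rw [h0, ENNReal.zero_rpow_of_neg (by linarith)] at this
    exact ENNReal.coe_ne_top (top_le_iff.1 this)
  have hfm := measurable_leafNormalize hker hπ hφm
  have henergy : ∫⁻ x, leafNormalize ν π φ x ^ p ∂μ < Modulus μ σ ν p S ^ p := by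
    rw [hFubini _ (hfm.pow_const p)]
    refine lt_of_le_of_lt (lintegral_mono_ae ?_) hhint
    filter_upwards [hleaf, hIfin] with y hl hfin
    by_cases hy : y ∈ S
    · rw [lintegral_leafNormalize_rpow_div hp hφm hφJ hl (by rw [hφS y hy hl]; exact hI0 y hy)
        (by rw [hφS y hy hl]; exact (hfin _).ne), hφS y hy hl]
      exact hkS y hy
    · rw [lintegral_leafNormalize_rpow_div_eq_zero hp hφm (hφSc y hy hl)]
      exact zero_le
  have hadm : IsAdmissible μ σ ν p S (leafNormalize ν π φ) := by
    refine ⟨hfm, henergy.trans_le le_top, ?_⟩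
    filter_upwards [hleaf, hIfin] with y hl hfin hy
    exact (lintegral_leafNormalize hφm hl (by rw [hφS y hy hl]; exact hI0 y hy)
      (by rw [hφS y hy hl]; exact (hfin _).ne)).ge
  have hle : Modulus μ σ ν p S ≤ (∫⁻ x, leafNormalize ν π φ x ^ p ∂μ) ^ (1 / p) :=
    iInf₂_le _ hadm
  rw [one_div, ENNReal.le_rpow_inv_iff hp0] at hle
  exact hle.not_gt henergy

end LeafNormalization

theorem statement_7
    {M N : Type*} [MeasurableSpace M] [MeasurableSpace N]
    (μ : Measure M) (σ : Measure N) [SigmaFinite μ] [SigmaFinite σ]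
    (ν : N → Measure M) (hνsf : ∀ y, SigmaFinite (ν y))
    (hker : ∀ A : Set M, MeasurableSet A → Measurable fun y => ν y A)
    (p : ℝ) (hp : 1 < p)
    (π : M → N) (hπ : Measurable π)
    (hleaf : ∀ᵐ y ∂σ, ν y (Set.univ \ π ⁻¹' {y}) = 0)
    (J : M → ℝ≥0∞) (hJ : Measurable J) (hJ0 : ∀ x, 0 < J x) (hJtop : ∀ x, J x < ∞)
    (hFubini : ∀ f : M → ℝ≥0∞, Measurable f →
      ∫⁻ x, f x ∂μ = ∫⁻ y, (∫⁻ x, f x / J x ∂(ν y)) ∂σ)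
    (hfin : Modulus μ σ ν p Set.univ < ∞)
    (hpos : ∀ S : Set N, MeasurableSet S → 0 < μ (π ⁻¹' S) → 0 < Modulus μ σ ν p S) :
    ∃ f₀ : M → ℝ≥0∞, IsExtremal μ σ ν p f₀ := by
  have hp0 : 0 < p := by linarith
  have hl : ∀ᵐ y ∂σ, ∀ᵐ x ∂(ν y), π x = y := hleaf.mono fun y hy => ae_leaf_eq hy
  have htop := ae_lintegral_rpow_ne_top hker hp hπ hl hJ hJ0 hJtop hFubini hpos
  have hwm : Measurable fun x => J x ^ (1 / (p - 1)) := hJ.pow_const _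
  set f₀ := leafNormalize ν π fun x => J x ^ (1 / (p - 1)) with hf₀
  have hf₀m : Measurable f₀ := measurable_leafNormalize hker hπ hwm
  obtain ⟨f, hf⟩ : ∃ f, IsAdmissible μ σ ν p Set.univ f := by
    by_contra! h
    simp [Modulus, h] at hfin
  have hne : ∀ᵐ y ∂σ, ∫⁻ x, J x ^ (1 / (p - 1)) ∂(ν y) ≠ 0 := by
    filter_upwards [hf.2.2] with y hy h0
    have hν : ν y = 0 := by
      rw [← ae_eq_bot, ← Filter.eventually_false_iff_eq_bot]
      filter_upwards [(lintegral_eq_zero_iff hwm).1 h0] with x hx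
      exact (ENNReal.rpow_pos (hJ0 x) (hJtop x).ne).ne' hx
    simp [hν] at hy
  have hmin : ∀ g, IsAdmissible μ σ ν p Set.univ g →
      ∫⁻ x, f₀ x ^ p ∂μ ≤ ∫⁻ x, g x ^ p ∂μ := fun g hg => by
    rw [hFubini _ (hf₀m.pow_const p), hFubini _ (hg.1.pow_const p)]
    refine lintegral_mono_ae ?_
    filter_upwards [hl, htop, hne, hg.2.2] with y hy hyt hy0 hg1
    rw [lintegral_leafNormalize_rpow_div hp hwm
      (fun x => rpow_conj_div_self hp (hJ0 x) (hJtop x)) hy hy0 hyt]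
    exact lintegral_rpow_le_of_one_le_lintegral hp hJ hJ0 hJtop hg.1 (hg1 trivial) hyt
  have hadm : IsAdmissible μ σ ν p Set.univ f₀ := by
    refine ⟨hf₀m, (hmin f hf).trans_lt hf.2.1, ?_⟩
    filter_upwards [hl, htop, hne] with y hy hyt hy0 _
    exact (lintegral_leafNormalize hwm hy hy0 hyt).ge
  exact ⟨f₀, hadm, le_antisymm
    (le_iInf₂ fun g hg => ENNReal.rpow_le_rpow (hmin g hg) (by positivity)) (iInf₂_le _ hadm)⟩
end

section
/- Assume that every measurable set S ⊆ N with μ(π⁻¹(S)) > 0 satisfies Mod_p(S) > 0. Then the set of p-admissible functions for N is closed under L^p(μ)-convergence: if each f_n : M → [0,∞] is p-admissible for N, f : M → [0,∞] is measurable, and ∫_M |f_n − f|^p dμ → 0, then f is p-admissible for N. -/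
open MeasureTheory ENNReal Filter

variable {M N : Type*}

theorem lintegral_rpow_lt_top_of_tendsto [MeasurableSpace M] {μ : Measure M} {p : ℝ} (hp : 1 ≤ p)
    {f : ℕ → M → ℝ≥0∞} {g : M → ℝ≥0∞} (hf : ∀ n, Measurable (f n))
    (hfp : ∀ n, (∫⁻ x, f n x ^ p ∂μ) < ∞)
    (hconv : Tendsto (fun n => ∫⁻ x, ((f n x - g x) ⊔ (g x - f n x)) ^ p ∂μ) atTop (nhds 0)) :
    (∫⁻ x, g x ^ p ∂μ) < ∞ := by
  obtain ⟨n, hn⟩ := (hconv.eventually (gt_mem_nhds zero_lt_top)).exists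
  refine (lintegral_mono fun x => ?_).trans_lt
    (lintegral_rpow_add_lt_top_of_lintegral_rpow_lt_top (hf n).aemeasurable (hfp n) hn hp)
  refine rpow_le_rpow ?_ (by linarith)
  exact le_add_tsub.trans (add_le_add le_rfl le_sup_right)

/-- If the preimage of `S` is null, then `σ`-almost every leaf over `S` is null. -/
theorem ae_leaf_eq_zero_of_preimage_null [MeasurableSpace M] [MeasurableSpace N]
    {μ : Measure M} {σ : Measure N} {ν : N → Measure M} (hν : Measurable ν)
    {π : M → N} (hπ : Measurable π)
    (hleaf : ∀ᵐ y ∂σ, ν y (Set.univ \ π ⁻¹' {y}) = 0)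
    {J : M → ℝ≥0∞} (hJ : Measurable J) (hJtop : ∀ x, J x < ∞)
    (hFubini : ∀ f : M → ℝ≥0∞, Measurable f →
      ∫⁻ x, f x ∂μ = ∫⁻ y, (∫⁻ x, f x / J x ∂(ν y)) ∂σ)
    {S : Set N} (hS : MeasurableSet S) (hnull : μ (π ⁻¹' S) = 0) :
    ∀ᵐ y ∂σ, y ∈ S → ν y = 0 := by
  have hA : Measurable ((π ⁻¹' S).indicator (1 : M → ℝ≥0∞)) :=
    measurable_one.indicator (hπ hS)
  have hq : Measurable fun x => (π ⁻¹' S).indicator (1 : M → ℝ≥0∞) x / J x := hA.div hJ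
  have h0 := hFubini _ hA
  rw [lintegral_indicator_one (hπ hS), hnull, eq_comm] at h0
  replace h0 := (lintegral_eq_zero_iff ((Measure.measurable_lintegral hq).comp hν)).1 h0
  filter_upwards [h0, hleaf] with y hy hl hyS
  have hy' := (lintegral_eq_zero_iff hq).1 hy
  have hl' : ∀ᵐ x ∂(ν y), x ∉ Set.univ \ π ⁻¹' {y} := measure_eq_zero_iff_ae_notMem.1 hl
  rw [← ae_eq_bot, ← eventually_false_iff_eq_bot]
  filter_upwards [hy', hl'] with x hx hxl
  have hxy : π x = y := by simpa using hxl
  have hxS : x ∈ π ⁻¹' S := by simpa [hxy] using hyS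
  simp [hxS, (hJtop x).ne] at hx

/-- The modulus of a set on which the leafwise integrals of `g` stay below `1` by a fixed margin
vanishes when `g` is an `L^p`-limit of functions admissible for the whole space. -/
theorem modulus_eq_zero_of_tendsto [MeasurableSpace M] [MeasurableSpace N]
    {μ : Measure M} {σ : Measure N} {ν : N → Measure M} {p : ℝ} (hp : 1 ≤ p)
    {f : ℕ → M → ℝ≥0∞} (hf : ∀ n, IsAdmissible μ σ ν p Set.univ (f n))
    {g : M → ℝ≥0∞} (hg : Measurable g)
    (hconv : Tendsto (fun n => ∫⁻ x, ((f n x - g x) ⊔ (g x - f n x)) ^ p ∂μ) atTop (nhds 0))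
    {ε : ℝ≥0∞} (hε : ε ≠ 0) (hε' : ε ≠ ∞) :
    Modulus μ σ ν p {y | ∫⁻ x, g x ∂(ν y) + ε ≤ 1} = 0 := by
  have hp0 : 0 < p := by linarith
  have hd : ∀ n, Measurable fun x => (f n x - g x) ⊔ (g x - f n x) := fun n =>
    ((hf n).1.sub hg).sup (hg.sub (hf n).1)
  have hc : ε⁻¹ ^ p ≠ ∞ := rpow_ne_top_of_nonneg hp0.le (inv_ne_top.2 hε)
  have hint : ∀ n, ∫⁻ x, (ε⁻¹ * ((f n x - g x) ⊔ (g x - f n x))) ^ p ∂μ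
      = ε⁻¹ ^ p * ∫⁻ x, ((f n x - g x) ⊔ (g x - f n x)) ^ p ∂μ := fun n => by
    simp_rw [mul_rpow_of_nonneg _ _ hp0.le]
    exact lintegral_const_mul _ ((hd n).pow_const p)
  have hlim : Tendsto (fun n => ∫⁻ x, (ε⁻¹ * ((f n x - g x) ⊔ (g x - f n x))) ^ p ∂μ)
      atTop (nhds 0) := by
    simp_rw [hint]
    simpa using ENNReal.Tendsto.const_mul hconv (Or.inr hc)
  have hlim' := (ENNReal.continuous_rpow_const (y := 1 / p)).continuousAt.tendsto.comp hlim
  rw [zero_rpow_of_pos (by positivity)] at hlim'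
  refine le_antisymm (ge_of_tendsto hlim' ?_) zero_le
  filter_upwards [hlim.eventually (gt_mem_nhds zero_lt_top)] with n hn
  refine iInf₂_le _ ⟨(hd n).const_mul _, hn, ?_⟩
  filter_upwards [(hf n).2.2] with y hy hyS
  rw [lintegral_const_mul _ (hd n)]
  have hgfin : ∫⁻ x, g x ∂(ν y) ≠ ∞ :=
    ne_top_of_le_ne_top one_ne_top (le_self_add.trans hyS)
  have hle : ∫⁻ x, g x ∂(ν y) + ε ≤
      ∫⁻ x, g x ∂(ν y) + ∫⁻ x, (f n x - g x) ⊔ (g x - f n x) ∂(ν y) := by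
    refine (le_trans hyS (hy trivial)).trans ?_
    rw [← lintegral_add_left hg]
    exact lintegral_mono fun x => le_add_tsub.trans (add_le_add le_rfl le_sup_left)
  rw [← ENNReal.inv_mul_cancel hε hε']
  gcongr
  exact (ENNReal.add_le_add_iff_left hgfin).1 hle

theorem statement_8
    {M N : Type*} [MeasurableSpace M] [MeasurableSpace N]
    (μ : Measure M) (σ : Measure N) [SigmaFinite μ] [SigmaFinite σ]
    (ν : N → Measure M) (hνsf : ∀ y, SigmaFinite (ν y))
    (hker : ∀ A : Set M, MeasurableSet A → Measurable fun y => ν y A)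
    (p : ℝ) (hp : 1 ≤ p)
    (π : M → N) (hπ : Measurable π)
    (hleaf : ∀ᵐ y ∂σ, ν y (Set.univ \ π ⁻¹' {y}) = 0)
    (J : M → ℝ≥0∞) (hJ : Measurable J) (hJ0 : ∀ x, 0 < J x) (hJtop : ∀ x, J x < ∞)
    (hFubini : ∀ f : M → ℝ≥0∞, Measurable f →
      ∫⁻ x, f x ∂μ = ∫⁻ y, (∫⁻ x, f x / J x ∂(ν y)) ∂σ)
    (hpos : ∀ S : Set N, MeasurableSet S → 0 < μ (π ⁻¹' S) → 0 < Modulus μ σ ν p S)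
    (f : ℕ → M → ℝ≥0∞) (hf : ∀ n, IsAdmissible μ σ ν p Set.univ (f n))
    (g : M → ℝ≥0∞) (hg : Measurable g)
    (hconv : Tendsto (fun n => ∫⁻ x, ((f n x - g x) ⊔ (g x - f n x)) ^ p ∂μ) atTop (nhds 0)) :
    IsAdmissible μ σ ν p Set.univ g := by
  have hν : Measurable ν := Measure.measurable_of_measurable_coe ν hker
  refine ⟨hg, lintegral_rpow_lt_top_of_tendsto hp (fun n => (hf n).1) (fun n => (hf n).2.1) hconv,
    ?_⟩
  have key : ∀ k : ℕ, ∀ᵐ y ∂σ, ¬ ∫⁻ x, g x ∂(ν y) + ((k + 1 : ℕ) : ℝ≥0∞)⁻¹ ≤ 1 := fun k => by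
    have hS : MeasurableSet {y | ∫⁻ x, g x ∂(ν y) + ((k + 1 : ℕ) : ℝ≥0∞)⁻¹ ≤ 1} :=
      measurableSet_le (((Measure.measurable_lintegral hg).comp hν).add_const _)
        measurable_const
    have hmod := modulus_eq_zero_of_tendsto hp hf hg hconv
      (ENNReal.inv_ne_zero.2 (natCast_ne_top (k + 1)))
      (inv_ne_top.2 (Nat.cast_ne_zero.2 k.succ_ne_zero))
    have hnull := nonpos_iff_eq_zero.1 (not_lt.1 fun h => (hpos _ hS h).ne' hmod)
    filter_upwards [ae_leaf_eq_zero_of_preimage_null hν hπ hleaf hJ hJtop hFubini hS hnull,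
      (hf 0).2.2] with y hy h1 hyS
    simpa [hy hyS] using h1 trivial
  filter_upwards [ae_all_iff.2 key] with y hy _
  by_contra! hlt
  obtain ⟨n, hn⟩ := ENNReal.exists_inv_nat_lt (tsub_pos_of_lt hlt).ne'
  refine hy n ?_
  rw [add_comm]
  refine (add_le_add_left ((ENNReal.inv_le_inv.2 ?_).trans hn.le) _).trans
    (tsub_add_cancel_of_le hlt.le).le
  exact_mod_cast n.le_succ
end

section
/- Assume 1 < p < ∞ and μ(M) < ∞. If there exists an extremal function for the p-modulus, then μ(π⁻¹({y ∈ N : ν_y(M) = ∞})) = 0 (i.e. the union of the leaves of infinite measure is μ-null). -/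
open MeasureTheory ENNReal Filter

variable {M N : Type*}

theorem ENNReal.le_of_forall_pos_le_add_mul {a b C : ℝ≥0∞} (hC : C ≠ ∞)
    (h : ∀ δ : ℝ≥0∞, 0 < δ → δ < ∞ → a ≤ b + δ * C) : a ≤ b := by
  have ht : Tendsto (fun δ : ℝ≥0∞ => b + δ * C) (nhdsWithin 0 (Set.Ioi 0)) (nhds b) := by
    have h1 : Tendsto (fun δ : ℝ≥0∞ => b + δ * C) (nhds 0) (nhds (b + 0 * C)) :=
      tendsto_const_nhds.add (ENNReal.Tendsto.mul_const tendsto_id (Or.inr hC))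
    simpa using h1.mono_left nhdsWithin_le_nhds
  refine ge_of_tendsto ht ?_
  filter_upwards [self_mem_nhdsWithin, nhdsWithin_le_nhds (Iio_mem_nhds ENNReal.zero_lt_top)]
    with δ h0 h1 using h δ h0 h1

section

variable [MeasurableSpace M] [MeasurableSpace N] {μ : Measure M} {σ : Measure N}
  {ν : N → Measure M} {p : ℝ} {f₀ : M → ℝ≥0∞}

theorem IsExtremal.lintegral_rpow_le (hp : 0 < p) (h : IsExtremal μ σ ν p f₀) {g : M → ℝ≥0∞}
    (hg : IsAdmissible μ σ ν p Set.univ g) : ∫⁻ x, f₀ x ^ p ∂μ ≤ ∫⁻ x, g x ^ p ∂μ := by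
  have : (∫⁻ x, f₀ x ^ p ∂μ) ^ (1 / p) ≤ (∫⁻ x, g x ^ p ∂μ) ^ (1 / p) :=
    h.2.trans_le (iInf₂_le g hg)
  exact (ENNReal.rpow_le_rpow_iff (by positivity)).1 this

theorem lintegral_rpow_piecewise_const {S : Set M} [DecidablePred (· ∈ S)]
    (hS : MeasurableSet S) (f : M → ℝ≥0∞) (c : ℝ≥0∞) :
    ∫⁻ x, S.piecewise (fun _ => c) f x ^ p ∂μ = ∫⁻ x in Sᶜ, f x ^ p ∂μ + c ^ p * μ S := by
  rw [← lintegral_add_compl _ hS, add_comm]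
  congr 1
  · exact setLIntegral_congr_fun hS.compl fun x hx => by
      simp [Set.piecewise_eq_of_notMem _ _ _ hx]
  · rw [← setLIntegral_const]
    exact setLIntegral_congr_fun hS fun x hx => by simp [Set.piecewise_eq_of_mem _ _ _ hx]

/-- Replacing an admissible function by a positive constant on the union of the leaves of infinite
measure keeps it admissible. -/
theorem IsAdmissible.piecewise_const [IsFiniteMeasure μ] (hp : 0 < p) {π : M → N}
    (hleaf : ∀ᵐ y ∂σ, ∀ᵐ x ∂(ν y), π x = y)
    (hS : MeasurableSet (π ⁻¹' {y | ν y Set.univ = ∞}))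
    [DecidablePred (· ∈ π ⁻¹' {y | ν y Set.univ = ∞})]
    (h : IsAdmissible μ σ ν p Set.univ f₀) {c : ℝ≥0∞} (hc0 : c ≠ 0) (hc : c ≠ ∞) :
    IsAdmissible μ σ ν p Set.univ
      ((π ⁻¹' {y | ν y Set.univ = ∞}).piecewise (fun _ => c) f₀) := by
  refine ⟨measurable_const.piecewise hS h.1, ?_, ?_⟩
  · rw [lintegral_rpow_piecewise_const hS]
    exact ENNReal.add_lt_top.2 ⟨(setLIntegral_le_lintegral _ _).trans_lt h.2.1,
      ENNReal.mul_lt_top (ENNReal.rpow_lt_top_of_nonneg hp.le hc) (measure_lt_top _ _)⟩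
  · filter_upwards [hleaf, h.2.2] with y hy hf _
    by_cases hE : ν y Set.univ = ∞
    · have : ∫⁻ x, (π ⁻¹' {y | ν y Set.univ = ∞}).piecewise (fun _ => c) f₀ x ∂(ν y)
          = ∫⁻ _, c ∂(ν y) := lintegral_congr_ae <| by
        filter_upwards [hy] with x hx
        exact Set.piecewise_eq_of_mem _ _ _ (by simpa [hx] using hE)
      rw [this, lintegral_const, hE, ENNReal.mul_top hc0]
      exact le_top
    · have : ∫⁻ x, (π ⁻¹' {y | ν y Set.univ = ∞}).piecewise (fun _ => c) f₀ x ∂(ν y)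
          = ∫⁻ x, f₀ x ∂(ν y) := lintegral_congr_ae <| by
        filter_upwards [hy] with x hx
        exact Set.piecewise_eq_of_notMem _ _ _ (by simpa [hx] using hE)
      exact this ▸ hf trivial

theorem IsExtremal.setLIntegral_rpow_eq_zero [IsFiniteMeasure μ] (hp : 0 < p) {π : M → N}
    (hleaf : ∀ᵐ y ∂σ, ∀ᵐ x ∂(ν y), π x = y)
    (hS : MeasurableSet (π ⁻¹' {y | ν y Set.univ = ∞})) (h : IsExtremal μ σ ν p f₀) :
    ∫⁻ x in π ⁻¹' {y | ν y Set.univ = ∞}, f₀ x ^ p ∂μ = 0 := by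
  classical
  set S := π ⁻¹' {y | ν y Set.univ = ∞} with hSdef
  have hle : ∫⁻ x, f₀ x ^ p ∂μ ≤ ∫⁻ x in Sᶜ, f₀ x ^ p ∂μ := by
    refine ENNReal.le_of_forall_pos_le_add_mul (measure_ne_top μ S) fun δ hδ hδ' => ?_
    have hadm := h.1.piecewise_const hp hleaf hS (c := δ ^ p⁻¹)
      (by simp [hδ.ne', hδ'.ne]) (ENNReal.rpow_ne_top_of_nonneg (by positivity) hδ'.ne)
    have := h.lintegral_rpow_le hp hadm
    rwa [lintegral_rpow_piecewise_const hS, ENNReal.rpow_inv_rpow hp.ne'] at this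
  have hfin : ∫⁻ x in Sᶜ, f₀ x ^ p ∂μ ≠ ∞ :=
    ((setLIntegral_le_lintegral _ _).trans_lt h.1.2.1).ne
  rw [← lintegral_add_compl _ hS] at hle
  have : ∫⁻ x in S, f₀ x ^ p ∂μ + ∫⁻ x in Sᶜ, f₀ x ^ p ∂μ
      ≤ 0 + ∫⁻ x in Sᶜ, f₀ x ^ p ∂μ := by simpa using hle
  exact nonpos_iff_eq_zero.1 ((ENNReal.add_le_add_iff_right hfin).1 this)

end

theorem statement_9
    {M N : Type*} [MeasurableSpace M] [MeasurableSpace N]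
    (μ : Measure M) (σ : Measure N) [SigmaFinite μ] [SigmaFinite σ]
    (ν : N → Measure M) (hνsf : ∀ y, SigmaFinite (ν y))
    (hker : ∀ A : Set M, MeasurableSet A → Measurable fun y => ν y A)
    (p : ℝ) (hp : 1 < p)
    (π : M → N) (hπ : Measurable π)
    (hleaf : ∀ᵐ y ∂σ, ν y (Set.univ \ π ⁻¹' {y}) = 0)
    (J : M → ℝ≥0∞) (hJ : Measurable J) (hJ0 : ∀ x, 0 < J x) (hJtop : ∀ x, J x < ∞)
    (hFubini : ∀ f : M → ℝ≥0∞, Measurable f →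
      ∫⁻ x, f x ∂μ = ∫⁻ y, (∫⁻ x, f x / J x ∂(ν y)) ∂σ)
    (hμfin : μ Set.univ < ∞)
    (hex : ∃ f₀ : M → ℝ≥0∞, IsExtremal μ σ ν p f₀) :
    μ (π ⁻¹' {y | ν y Set.univ = ∞}) = 0 := by
  have hp0 : 0 < p := by linarith
  have : IsFiniteMeasure μ := ⟨hμfin⟩
  have hleaf' : ∀ᵐ y ∂σ, ∀ᵐ x ∂(ν y), π x = y := by
    filter_upwards [hleaf] with y hy
    rwa [← Set.compl_eq_univ_sdiff] at hy
  have hE : MeasurableSet {y | ν y Set.univ = ∞} :=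
    hker _ MeasurableSet.univ (measurableSet_singleton ∞)
  have hS : MeasurableSet (π ⁻¹' {y | ν y Set.univ = ∞}) := hπ hE
  obtain ⟨f₀, hf₀⟩ := hex
  have hνker : Measurable ν := Measure.measurable_of_measurable_coe _ hker
  have hzero := hf₀.setLIntegral_rpow_eq_zero hp0 hleaf' hS
  set S := π ⁻¹' {y | ν y Set.univ = ∞} with hSdef
  have hmeas : Measurable (S.indicator fun x => f₀ x ^ p) :=
    (hf₀.1.1.pow_const p).indicator hS
  have hmeasJ : Measurable fun x => S.indicator (fun x => f₀ x ^ p) x / J x := hmeas.div hJ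
  have hmeasInt : Measurable fun y => ∫⁻ x, S.indicator (fun x => f₀ x ^ p) x / J x ∂(ν y) :=
    (Measure.measurable_lintegral hmeasJ).comp hνker
  rw [← lintegral_indicator hS, hFubini _ hmeas, lintegral_eq_zero_iff hmeasInt] at hzero
  have hfin : ∀ᵐ y ∂σ, ν y Set.univ ≠ ∞ := by
    filter_upwards [hleaf', hzero, hf₀.1.2.2] with y hy hz hadm hyE
    have hf : ∫⁻ x, f₀ x ∂(ν y) = 0 := by
      rw [lintegral_eq_zero_iff hf₀.1.1]
      filter_upwards [hy, (lintegral_eq_zero_iff hmeasJ).1 hz] with x hx hzx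
      have hxS : x ∈ S := by simpa [hSdef, hx] using hyE
      simpa [hxS, ENNReal.div_eq_zero_iff, (hJtop x).ne, hp0, hp0.not_gt] using hzx
    simpa [hf] using hadm trivial
  rw [← lintegral_indicator_one hS, hFubini _ (measurable_one.indicator hS)]
  refine lintegral_eq_zero_of_ae_eq_zero ?_
  filter_upwards [hleaf', hfin] with y hy hyE
  refine lintegral_eq_zero_of_ae_eq_zero ?_
  filter_upwards [hy] with x hx
  have hxS : x ∉ S := by simpa [hSdef, hx] using hyE
  simp [hxS]
end

section
/- Assume 1 < p < ∞ and that there exists a constant C with J(x) < C for all x ∈ M. If S ⊆ N is measurable with Mod_p(S) = 0, then μ(π⁻¹({y ∈ S : ν_y(M) < ∞})) = 0 (i.e. up to a μ-null union of leaves, every leaf indexed by S has infinite measure). -/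
open MeasureTheory ENNReal Filter

variable {M N : Type*}

/-- If `f` has integral at least one, then Hölder's inequality bounds the integral of `f ^ p` from
below by a power of the inverse of the total mass. -/
theorem inv_measure_univ_rpow_le_lintegral_rpow {α : Type*} [MeasurableSpace α] (m : Measure α)
    {p q : ℝ} (hpq : p.HolderConjugate q) {f : α → ℝ≥0∞} (hf : AEMeasurable f m)
    (h : 1 ≤ ∫⁻ x, f x ∂m) :
    (m Set.univ ^ (p / q))⁻¹ ≤ ∫⁻ x, f x ^ p ∂m := by
  have holder := ENNReal.lintegral_mul_le_Lp_mul_Lq m hpq hf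
    (aemeasurable_const (b := (1 : ℝ≥0∞)))
  simp only [Pi.mul_apply, mul_one, ENNReal.one_rpow, lintegral_const, one_mul] at holder
  have key := ENNReal.rpow_le_rpow (h.trans holder) hpq.nonneg
  rw [ENNReal.one_rpow, ENNReal.mul_rpow_of_nonneg _ _ hpq.nonneg, ← ENNReal.rpow_mul,
    ← ENNReal.rpow_mul, one_div_mul_cancel hpq.ne_zero, ENNReal.rpow_one,
    one_div_mul_eq_div] at key
  rw [← one_div]
  exact ENNReal.div_le_of_le_mul key

/-- If the Jacobian is bounded by `C`, the iterated integral over the leaves is at most `C` times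
the integral over the total space. -/
theorem lintegral_lintegral_le_mul_of_jacobian_lt {M N : Type*} [MeasurableSpace M]
    [MeasurableSpace N] {μ : Measure M} {σ : Measure N} {ν : N → Measure M} {J : M → ℝ≥0∞}
    (hJ0 : ∀ x, 0 < J x)
    (hFubini : ∀ f : M → ℝ≥0∞, Measurable f →
      ∫⁻ x, f x ∂μ = ∫⁻ y, (∫⁻ x, f x / J x ∂(ν y)) ∂σ)
    {C : NNReal} (hC : ∀ x, J x < (C : ℝ≥0∞)) {f : M → ℝ≥0∞} (hf : Measurable f) :
    ∫⁻ y, (∫⁻ x, f x ∂(ν y)) ∂σ ≤ C * ∫⁻ x, f x ∂μ := by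
  rw [hFubini f hf, ← lintegral_const_mul' _ _ ENNReal.coe_ne_top]
  refine lintegral_mono fun y => ?_
  rw [← lintegral_const_mul' _ _ ENNReal.coe_ne_top]
  refine lintegral_mono fun x => ?_
  calc f x = J x * (f x / J x) := (ENNReal.mul_div_cancel (hJ0 x).ne' (hC x).ne_top).symm
    _ ≤ C * (f x / J x) := by gcongr; exact (hC x).le

theorem statement_10
    {M N : Type*} [MeasurableSpace M] [MeasurableSpace N]
    (μ : Measure M) (σ : Measure N) [SigmaFinite μ] [SigmaFinite σ]
    (ν : N → Measure M) (hνsf : ∀ y, SigmaFinite (ν y))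
    (hker : ∀ A : Set M, MeasurableSet A → Measurable fun y => ν y A)
    (p : ℝ) (hp : 1 < p)
    (π : M → N) (hπ : Measurable π)
    (hleaf : ∀ᵐ y ∂σ, ν y (Set.univ \ π ⁻¹' {y}) = 0)
    (J : M → ℝ≥0∞) (hJ : Measurable J) (hJ0 : ∀ x, 0 < J x) (hJtop : ∀ x, J x < ∞)
    (hFubini : ∀ f : M → ℝ≥0∞, Measurable f →
      ∫⁻ x, f x ∂μ = ∫⁻ y, (∫⁻ x, f x / J x ∂(ν y)) ∂σ)
    (C : NNReal) (hC : ∀ x, J x < (C : ℝ≥0∞))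
    (S : Set N) (hS : MeasurableSet S) (hmod : Modulus μ σ ν p S = 0) :
    μ (π ⁻¹' {y | y ∈ S ∧ ν y Set.univ < ∞}) = 0 := by
  have hpq := Real.HolderConjugate.conjExponent hp
  set q := p.conjExponent
  have hg : Measurable fun y => ((ν y Set.univ) ^ (p / q))⁻¹ :=
    ((hker _ .univ).pow_const _).inv
  have hle : ((∫⁻ y in S, ((ν y Set.univ) ^ (p / q))⁻¹ ∂σ) / C) ^ (1 / p) ≤
      Modulus μ σ ν p S := by
    refine le_iInf₂ fun f hf => ENNReal.rpow_le_rpow ?_ (one_div_nonneg.2 hpq.nonneg)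
    obtain ⟨hfm, -, hf1⟩ := hf
    refine ENNReal.div_le_of_le_mul' ?_
    calc ∫⁻ y in S, ((ν y Set.univ) ^ (p / q))⁻¹ ∂σ
        ≤ ∫⁻ y in S, (∫⁻ x, f x ^ p ∂(ν y)) ∂σ :=
          lintegral_mono_ae <| (ae_restrict_iff' hS).2 <| hf1.mono fun y hy hyS =>
            inv_measure_univ_rpow_le_lintegral_rpow _ hpq hfm.aemeasurable (hy hyS)
      _ ≤ ∫⁻ y, (∫⁻ x, f x ^ p ∂(ν y)) ∂σ := setLIntegral_le_lintegral _ _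
      _ ≤ C * ∫⁻ x, f x ^ p ∂μ :=
          lintegral_lintegral_le_mul_of_jacobian_lt hJ0 hFubini hC (hfm.pow_const p)
  rw [hmod, nonpos_iff_eq_zero, ENNReal.rpow_eq_zero_iff_of_pos (one_div_pos.2 hpq.pos),
    ENNReal.div_eq_zero_iff, or_iff_left ENNReal.coe_ne_top, lintegral_eq_zero_iff hg,
    EventuallyEq, ae_restrict_iff' hS] at hle
  have hT : MeasurableSet {y | y ∈ S ∧ ν y Set.univ < ∞} :=
    hS.inter (measurableSet_lt (hker _ .univ) measurable_const)
  rw [← lintegral_indicator_one (hπ hT), hFubini _ (measurable_one.indicator (hπ hT)),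
    lintegral_eq_zero_of_ae_eq_zero]
  filter_upwards [hle, hleaf] with y hy hyleaf
  refine lintegral_eq_zero_of_ae_eq_zero ?_
  have hyπ : ∀ᵐ x ∂(ν y), π x = y := by
    rw [← Set.compl_eq_univ_sdiff] at hyleaf
    exact hyleaf
  filter_upwards [hyπ] with x hx
  have hxT : x ∉ π ⁻¹' {y | y ∈ S ∧ ν y Set.univ < ∞} := by
    rintro ⟨hxS, hfin⟩
    rw [hx] at hxS hfin
    exact ENNReal.rpow_ne_top_of_nonneg (div_nonneg hpq.nonneg hpq.symm.nonneg) hfin.ne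
      (ENNReal.inv_eq_zero.1 (hy hxS))
  rw [Set.indicator_of_notMem hxT, ENNReal.zero_div, Pi.zero_apply]
end

section
/- Assume 1 < p < ∞, μ(M) < ∞, Mod_p(N) < ∞, and that there exists a constant C with J(x) < C for all x ∈ M. Then an extremal function for the p-modulus exists if and only if μ(π⁻¹({y ∈ N : ν_y(M) = ∞})) = 0. -/
open MeasureTheory ENNReal Filter

variable {M N : Type*}

/-- Hölder's inequality with weight `J`: an upper bound for `∫ f` in terms of the weighted
`p`-energy `∫ f ^ p / J` turns `1 ≤ ∫ f` into a lower bound for that energy. -/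
theorem rpow_neg_lintegral_le_of_one_le_lintegral [MeasurableSpace M] {ν : Measure M} {p : ℝ}
    (hp : 1 < p) {J : M → ℝ≥0∞} (hJ : Measurable J) (hJ0 : ∀ x, 0 < J x) (hJtop : ∀ x, J x < ∞)
    {f : M → ℝ≥0∞} (hf : Measurable f) (h1 : 1 ≤ ∫⁻ x, f x ∂ν) :
    (∫⁻ x, J x ^ (1 / (p - 1)) ∂ν) ^ (-(p - 1)) ≤ ∫⁻ x, f x ^ p / J x ∂ν := by
  have hp0 : 0 < p := by linarith
  have hp1 : 0 < p - 1 := by linarith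
  have hpq : p.HolderConjugate (p / (p - 1)) := Real.HolderConjugate.conjExponent hp
  have hsplit : ∀ x, f x = f x * J x ^ (-(1 / p)) * J x ^ (1 / p) := fun x => by
    rw [mul_assoc, ← ENNReal.rpow_add _ _ (hJ0 x).ne' (hJtop x).ne]
    simp
  have henergy : ∀ x, (f x * J x ^ (-(1 / p))) ^ p = f x ^ p / J x := fun x => by
    rw [ENNReal.mul_rpow_of_nonneg _ _ hp0.le, ← ENNReal.rpow_mul,
      show -(1 / p) * p = -1 by field_simp, ENNReal.rpow_neg_one, div_eq_mul_inv]
  have hweight : ∀ x, (J x ^ (1 / p)) ^ (p / (p - 1)) = J x ^ (1 / (p - 1)) := fun x => by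
    rw [← ENNReal.rpow_mul]
    congr 1
    field_simp
  have holder := ENNReal.lintegral_mul_le_Lp_mul_Lq ν hpq
    (f := fun x => f x * J x ^ (-(1 / p))) (g := fun x => J x ^ (1 / p))
    (by fun_prop) (by fun_prop)
  simp only [Pi.mul_apply, ← hsplit, henergy, hweight] at holder
  have hpow := ENNReal.rpow_le_rpow (h1.trans holder) hp0.le
  rw [ENNReal.one_rpow, ENNReal.mul_rpow_of_nonneg _ _ hp0.le, ← ENNReal.rpow_mul,
    ← ENNReal.rpow_mul, show 1 / p * p = 1 by field_simp, ENNReal.rpow_one,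
    show 1 / (p / (p - 1)) * p = p - 1 by field_simp] at hpow
  rw [ENNReal.rpow_neg]
  simpa using ENNReal.div_le_of_le_mul hpow

/-- The `ν`-energy of the normalized weight `J ^ (1 / (p - 1)) / ∫ J ^ (1 / (p - 1)) ∂ν`. -/
theorem lintegral_normalized_rpow_div [MeasurableSpace M] {ν : Measure M} {p : ℝ}
    (hp : 1 < p) {J : M → ℝ≥0∞} (hJ : Measurable J) (hJ0 : ∀ x, 0 < J x) (hJtop : ∀ x, J x < ∞)
    {c : ℝ≥0∞} (hc : ∫⁻ x, J x ^ (1 / (p - 1)) ∂ν = c) (hc0 : c ≠ 0) (hctop : c ≠ ∞) :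
    ∫⁻ x, (J x ^ (1 / (p - 1)) / c) ^ p / J x ∂ν = c ^ (-(p - 1)) := by
  have hp0 : 0 < p := by linarith
  have hp1 : 0 < p - 1 := by linarith
  have hpoint : ∀ x, (J x ^ (1 / (p - 1)) / c) ^ p / J x = J x ^ (1 / (p - 1)) * c ^ (-p) :=
    fun x => by
      rw [ENNReal.div_rpow_of_nonneg _ _ hp0.le, ← ENNReal.rpow_mul, div_eq_mul_inv,
        div_eq_mul_inv, mul_right_comm, ← ENNReal.rpow_neg_one (J x),
        ← ENNReal.rpow_add _ _ (hJ0 x).ne' (hJtop x).ne, ← ENNReal.rpow_neg]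
      congr 2
      field_simp
      ring
  simp only [hpoint]
  rw [lintegral_mul_const _ (by fun_prop), hc]
  nth_rewrite 1 [← ENNReal.rpow_one c]
  rw [← ENNReal.rpow_add _ _ hc0 hctop]
  congr 1
  ring

/-- If the total mass `∫∫ J⁻¹ dν_y dσ` is finite and `J` is bounded, almost every leaf has
finite mass. -/
theorem ae_measure_univ_ne_top [MeasurableSpace M] [MeasurableSpace N]
    {μ : Measure M} {σ : Measure N} {ν : N → Measure M} (hν : Measurable ν)
    {J : M → ℝ≥0∞} (hJ : Measurable J) (hJ0 : ∀ x, 0 < J x) (hJtop : ∀ x, J x < ∞)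
    (hFubini : ∀ f : M → ℝ≥0∞, Measurable f →
      ∫⁻ x, f x ∂μ = ∫⁻ y, (∫⁻ x, f x / J x ∂(ν y)) ∂σ)
    (hμfin : μ Set.univ < ∞) {C : NNReal} (hC : ∀ x, J x < (C : ℝ≥0∞)) :
    ∀ᵐ y ∂σ, ν y Set.univ ≠ ∞ := by
  have hmass : ∫⁻ y, (∫⁻ x, 1 / J x ∂(ν y)) ∂σ ≠ ∞ := by
    rw [← hFubini (fun _ => 1) measurable_const]
    simpa using hμfin.ne
  have hmeas : Measurable fun y => ∫⁻ x, 1 / J x ∂(ν y) :=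
    (Measure.measurable_lintegral (by fun_prop)).comp hν
  filter_upwards [ae_lt_top hmeas hmass] with y hy
  have hle : ν y Set.univ ≤ C * ∫⁻ x, 1 / J x ∂(ν y) := by
    rw [← lintegral_const_mul _ (by fun_prop), ← lintegral_one]
    refine lintegral_mono fun x => ?_
    rw [mul_one_div, ENNReal.le_div_iff_mul_le (.inl (hJ0 x).ne') (.inl (hJtop x).ne), one_mul]
    exact (hC x).le
  exact (hle.trans_lt (ENNReal.mul_lt_top ENNReal.coe_lt_top hy)).ne

theorem isExtremal_of_forall_le [MeasurableSpace M] [MeasurableSpace N]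
    {μ : Measure M} {σ : Measure N} {ν : N → Measure M} {p : ℝ} (hp : 0 < p) {f₀ : M → ℝ≥0∞}
    (h₀ : IsAdmissible μ σ ν p Set.univ f₀)
    (hmin : ∀ f, IsAdmissible μ σ ν p Set.univ f → ∫⁻ x, f₀ x ^ p ∂μ ≤ ∫⁻ x, f x ^ p ∂μ) :
    IsExtremal μ σ ν p f₀ :=
  ⟨h₀, le_antisymm
    (le_iInf₂ fun f hf => ENNReal.rpow_le_rpow (hmin f hf) (one_div_nonneg.2 hp.le))
    (iInf₂_le f₀ h₀)⟩

theorem exists_isAdmissible_of_modulus_lt_top [MeasurableSpace M] [MeasurableSpace N]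
    {μ : Measure M} {σ : Measure N} {ν : N → Measure M} {p : ℝ} {S : Set N}
    (hfin : Modulus μ σ ν p S < ∞) : ∃ f, IsAdmissible μ σ ν p S f := by
  obtain ⟨f, hf⟩ := iInf_lt_iff.1 hfin
  exact ⟨f, (iInf_lt_iff.1 hf).1⟩

/-- If almost every leaf has finite mass, the leafwise normalization of `J ^ (1 / (p - 1))` is
extremal. -/
theorem exists_isExtremal [MeasurableSpace M] [MeasurableSpace N]
    {μ : Measure M} {σ : Measure N} {ν : N → Measure M} (hν : Measurable ν)
    {p : ℝ} (hp : 1 < p) {π : M → N} (hπ : Measurable π)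
    (hleaf : ∀ᵐ y ∂σ, ∀ᵐ x ∂(ν y), π x = y)
    {J : M → ℝ≥0∞} (hJ : Measurable J) (hJ0 : ∀ x, 0 < J x) (hJtop : ∀ x, J x < ∞)
    (hFubini : ∀ f : M → ℝ≥0∞, Measurable f →
      ∫⁻ x, f x ∂μ = ∫⁻ y, (∫⁻ x, f x / J x ∂(ν y)) ∂σ)
    (hfin : Modulus μ σ ν p Set.univ < ∞)
    {C : NNReal} (hC : ∀ x, J x < (C : ℝ≥0∞)) (hνfin : ∀ᵐ y ∂σ, ν y Set.univ ≠ ∞) :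
    ∃ f₀ : M → ℝ≥0∞, IsExtremal μ σ ν p f₀ := by
  have hp0 : 0 < p := by linarith
  have hp1 : 0 < p - 1 := by linarith
  obtain ⟨g, hg, hgfin, hg1⟩ := exists_isAdmissible_of_modulus_lt_top hfin
  set K : N → ℝ≥0∞ := fun y => ∫⁻ x, J x ^ (1 / (p - 1)) ∂(ν y) with hK
  have hKmeas : Measurable K := (Measure.measurable_lintegral (by fun_prop)).comp hν
  have hKtop : ∀ᵐ y ∂σ, K y ≠ ∞ := by
    filter_upwards [hνfin] with y hy
    have hle : K y ≤ (C : ℝ≥0∞) ^ (1 / (p - 1)) * ν y Set.univ := by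
      rw [← lintegral_const]
      exact lintegral_mono fun x => ENNReal.rpow_le_rpow (hC x).le (by positivity)
    exact (hle.trans_lt (ENNReal.mul_lt_top
      (ENNReal.rpow_lt_top_of_nonneg (by positivity) ENNReal.coe_ne_top) hy.lt_top)).ne
  have hK0 : ∀ᵐ y ∂σ, K y ≠ 0 := by
    filter_upwards [hg1] with y hy hzero
    rw [hK, lintegral_eq_zero_iff (by fun_prop)] at hzero
    have hfalse : ∀ᵐ x ∂(ν y), False := by
      filter_upwards [hzero] with x hx
      exact (ENNReal.rpow_pos (hJ0 x) (hJtop x).ne).ne' hx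
    have hνy : ν y = 0 := by simpa using hfalse
    simpa [hνy] using hy trivial
  set f₀ : M → ℝ≥0∞ := fun x => J x ^ (1 / (p - 1)) / K (π x)
  have hf₀ : Measurable f₀ := by fun_prop
  have henergy : ∫⁻ x, f₀ x ^ p ∂μ = ∫⁻ y, K y ^ (-(p - 1)) ∂σ := by
    rw [hFubini _ (by fun_prop)]
    refine lintegral_congr_ae ?_
    filter_upwards [hleaf, hK0, hKtop] with y hy h0 htop
    rw [← lintegral_normalized_rpow_div hp hJ hJ0 hJtop (c := K y) rfl h0 htop]
    refine lintegral_congr_ae ?_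
    filter_upwards [hy] with x hx
    simp only [f₀, hx]
  have hmin : ∀ f, IsAdmissible μ σ ν p Set.univ f →
      ∫⁻ x, f₀ x ^ p ∂μ ≤ ∫⁻ x, f x ^ p ∂μ := by
    rintro f ⟨hf, -, hf1⟩
    rw [henergy, hFubini _ (by fun_prop)]
    refine lintegral_mono_ae ?_
    filter_upwards [hf1] with y hy
    exact rpow_neg_lintegral_le_of_one_le_lintegral hp hJ hJ0 hJtop hf (hy trivial)
  refine ⟨f₀, isExtremal_of_forall_le hp0
    ⟨hf₀, (hmin g ⟨hg, hgfin, hg1⟩).trans_lt hgfin, ?_⟩ hmin⟩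
  filter_upwards [hleaf, hK0, hKtop] with y hy h0 htop _
  have hint : ∫⁻ x, f₀ x ∂(ν y) = ∫⁻ x, J x ^ (1 / (p - 1)) * (K y)⁻¹ ∂(ν y) := by
    refine lintegral_congr_ae ?_
    filter_upwards [hy] with x hx
    simp only [f₀, hx, div_eq_mul_inv]
  rw [hint, lintegral_mul_const _ (by fun_prop)]
  exact (ENNReal.mul_inv_cancel h0 htop).ge

theorem statement_11
    {M N : Type*} [MeasurableSpace M] [MeasurableSpace N]
    (μ : Measure M) (σ : Measure N) [SigmaFinite μ] [SigmaFinite σ]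
    (ν : N → Measure M) (hνsf : ∀ y, SigmaFinite (ν y))
    (hker : ∀ A : Set M, MeasurableSet A → Measurable fun y => ν y A)
    (p : ℝ) (hp : 1 < p)
    (π : M → N) (hπ : Measurable π)
    (hleaf : ∀ᵐ y ∂σ, ν y (Set.univ \ π ⁻¹' {y}) = 0)
    (J : M → ℝ≥0∞) (hJ : Measurable J) (hJ0 : ∀ x, 0 < J x) (hJtop : ∀ x, J x < ∞)
    (hFubini : ∀ f : M → ℝ≥0∞, Measurable f →
      ∫⁻ x, f x ∂μ = ∫⁻ y, (∫⁻ x, f x / J x ∂(ν y)) ∂σ)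
    (hμfin : μ Set.univ < ∞) (hfin : Modulus μ σ ν p Set.univ < ∞)
    (C : NNReal) (hC : ∀ x, J x < (C : ℝ≥0∞)) :
    (∃ f₀ : M → ℝ≥0∞, IsExtremal μ σ ν p f₀) ↔ μ (π ⁻¹' {y | ν y Set.univ = ∞}) = 0 := by
  have hν : Measurable ν := Measure.measurable_of_measurable_coe _ hker
  have hleaf' : ∀ᵐ y ∂σ, ∀ᵐ x ∂(ν y), π x = y := by
    filter_upwards [hleaf] with y hy
    rwa [← Set.compl_eq_univ_sdiff] at hy
  have hνfin := ae_measure_univ_ne_top hν hJ hJ0 hJtop hFubini hμfin hC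
  refine iff_of_true (exists_isExtremal hν hp hπ hleaf' hJ hJ0 hJtop hFubini hfin hC hνfin) ?_
  have hB : MeasurableSet {y | ν y Set.univ = ∞} :=
    hker _ MeasurableSet.univ (measurableSet_singleton ∞)
  rw [← lintegral_indicator_one (hπ hB), hFubini _ (measurable_one.indicator (hπ hB)),
    ← lintegral_zero (μ := σ)]
  refine lintegral_congr_ae ?_
  filter_upwards [hleaf', hνfin] with y hy hfiny
  rw [← lintegral_zero (μ := ν y)]
  refine lintegral_congr_ae ?_
  filter_upwards [hy] with x hx
  simp [hx, hfiny]
end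

section
/- If f₀ is an extremal function for the p-modulus, then ∫_M f₀ dν_y = 1 for σ-almost every y ∈ N. -/
open MeasureTheory ENNReal Filter

variable {M N : Type*}

/-- If a disintegration of `μ` along `ν` with a finite positive density holds, then a measurable
property holding `μ`-a.e. holds `ν y`-a.e. for `σ`-a.e. `y`. -/
theorem ae_ae_of_ae_of_disintegration {M N : Type*} [MeasurableSpace M] [MeasurableSpace N]
    {μ : Measure M} {σ : Measure N} {ν : N → Measure M} (hν : Measurable ν)
    {J : M → ℝ≥0∞} (hJ : Measurable J) (hJtop : ∀ x, J x < ∞)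
    (hFubini : ∀ f : M → ℝ≥0∞, Measurable f →
      ∫⁻ x, f x ∂μ = ∫⁻ y, (∫⁻ x, f x / J x ∂(ν y)) ∂σ)
    {P : M → Prop} (hP : MeasurableSet {x | P x}) (h : ∀ᵐ x ∂μ, P x) :
    ∀ᵐ y ∂σ, ∀ᵐ x ∂(ν y), P x := by
  have hind : Measurable ({x | P x}ᶜ.indicator (1 : M → ℝ≥0∞)) :=
    measurable_one.indicator hP.compl
  have hquot := hind.div hJ
  have hzero := hFubini _ hind
  rw [lintegral_indicator_one hP.compl, show μ {x | P x}ᶜ = 0 from h, eq_comm] at hzero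
  have hzero' := (lintegral_eq_zero_iff ((Measure.measurable_lintegral hquot).comp hν)).1 hzero
  filter_upwards [hzero'] with y hy
  have hy' := (lintegral_eq_zero_iff hquot).1 hy
  filter_upwards [hy'] with x hx
  by_contra hPx
  simp [hPx, (hJtop x).ne] at hx

theorem statement_12
    {M N : Type*} [MeasurableSpace M] [MeasurableSpace N]
    (μ : Measure M) (σ : Measure N) [SigmaFinite μ] [SigmaFinite σ]
    (ν : N → Measure M) (hνsf : ∀ y, SigmaFinite (ν y))
    (hker : ∀ A : Set M, MeasurableSet A → Measurable fun y => ν y A)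
    (p : ℝ) (hp : 1 ≤ p)
    (π : M → N) (hπ : Measurable π)
    (hleaf : ∀ᵐ y ∂σ, ν y (Set.univ \ π ⁻¹' {y}) = 0)
    (J : M → ℝ≥0∞) (hJ : Measurable J) (hJ0 : ∀ x, 0 < J x) (hJtop : ∀ x, J x < ∞)
    (hFubini : ∀ f : M → ℝ≥0∞, Measurable f →
      ∫⁻ x, f x ∂μ = ∫⁻ y, (∫⁻ x, f x / J x ∂(ν y)) ∂σ)
    (f₀ : M → ℝ≥0∞) (hf₀ : IsExtremal μ σ ν p f₀) :
    ∀ᵐ y ∂σ, (∫⁻ x, f₀ x ∂(ν y)) = 1 := by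
  obtain ⟨⟨hf, hfin, hadm⟩, hmod⟩ := hf₀
  have hp0 : 0 < p := by linarith
  have hν : Measurable ν := Measure.measurable_of_measurable_coe _ hker
  set F : N → ℝ≥0∞ := fun y => ∫⁻ x, f₀ x ∂(ν y) with hF
  have hFm : Measurable F := (Measure.measurable_lintegral hf).comp hν
  -- Truncating at `2` also covers the leaves on which the integral of `f₀` is infinite.
  set c : N → ℝ≥0∞ := fun y => max 1 (min (F y) 2) with hc
  have hcm : Measurable c := measurable_const.max (hFm.min measurable_const)
  have hc1 : ∀ y, 1 ≤ c y := fun y => le_max_left _ _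
  have hctop : ∀ y, c y ≠ ∞ := fun y =>
    ((max_le (by norm_num) (min_le_right _ _) : c y ≤ 2).trans_lt (by simp)).ne
  set g : M → ℝ≥0∞ := fun x => f₀ x / c (π x) with hg
  have hgm : Measurable g := hf.div (hcm.comp hπ)
  have hgf : ∀ x, g x ≤ f₀ x := fun x =>
    (ENNReal.div_le_div_left (hc1 _) _).trans (by simp)
  have hgp : ∀ x, g x ^ p ≤ f₀ x ^ p := fun x => ENNReal.rpow_le_rpow (hgf x) hp0.le
  have hleaf' : ∀ᵐ y ∂σ, ∀ᵐ x ∂(ν y), π x = y := by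
    filter_upwards [hleaf] with y hy
    rw [ae_iff]
    convert hy using 2
    ext x
    simp
  have hgadm : IsAdmissible μ σ ν p Set.univ g := by
    refine ⟨hgm, (lintegral_mono hgp).trans_lt hfin, ?_⟩
    filter_upwards [hleaf', hadm] with y hy hFy _
    have hFy : 1 ≤ F y := hFy trivial
    have hint : ∫⁻ x, g x ∂(ν y) = F y / c y := by
      have : ∫⁻ x, g x ∂(ν y) = ∫⁻ x, f₀ x * (c y)⁻¹ ∂(ν y) := by
        refine lintegral_congr_ae ?_
        filter_upwards [hy] with x hx
        simp only [hg, hx, div_eq_mul_inv]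
      rw [this, lintegral_mul_const _ hf, div_eq_mul_inv]
    rw [hint, ENNReal.le_div_iff_mul_le (Or.inl (by have := hc1 y; positivity))
      (Or.inl (hctop y)), one_mul]
    exact max_le hFy (min_le_left _ _)
  have hle : ∫⁻ x, f₀ x ^ p ∂μ ≤ ∫⁻ x, g x ^ p ∂μ := by
    have h : (∫⁻ x, f₀ x ^ p ∂μ) ^ (1 / p) ≤ (∫⁻ x, g x ^ p ∂μ) ^ (1 / p) :=
      hmod.trans_le (iInf₂_le g hgadm)
    exact (ENNReal.rpow_le_rpow_iff (by positivity)).1 h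
  have hfpm : Measurable fun x => f₀ x ^ p := hf.pow_const p
  have heq := ae_eq_of_ae_le_of_lintegral_le (ae_of_all μ hgp)
    ((lintegral_mono hgp).trans_lt hfin).ne hfpm.aemeasurable hle
  have hdich : ∀ᵐ x ∂μ, f₀ x = 0 ∨ c (π x) = 1 := by
    filter_upwards [heq, ae_lt_top hfpm hfin.ne] with x hx hxtop
    have hxtop' : f₀ x ≠ ∞ := by
      intro h
      simp [h, hp0] at hxtop
    have hx' : f₀ x / c (π x) = f₀ x := (ENNReal.rpow_left_injective hp0.ne') hx
    by_cases h0 : f₀ x = 0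
    · exact Or.inl h0
    · right
      rw [div_eq_mul_inv] at hx'
      have := (ENNReal.mul_right_inj h0 hxtop').1 (hx'.trans (mul_one _).symm)
      simpa using this
  have hset : MeasurableSet {x | f₀ x = 0 ∨ c (π x) = 1} :=
    (hf (measurableSet_singleton 0)).union ((hcm.comp hπ) (measurableSet_singleton 1))
  filter_upwards [ae_ae_of_ae_of_disintegration hν hJ hJtop hFubini hset hdich, hleaf', hadm]
    with y hy hπy hFy
  have hFy : 1 ≤ F y := hFy trivial
  change F y = 1
  by_cases hcy : c y = 1
  · have : min (F y) 2 ≤ 1 := hcy ▸ le_max_right _ _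
    rcases min_le_iff.1 this with h | h
    · exact h.antisymm hFy
    · norm_num at h
  · have : F y = 0 := by
      refine (lintegral_eq_zero_iff hf).2 ?_
      filter_upwards [hy, hπy] with x hx hxy
      exact hx.resolve_right (hxy.symm ▸ hcy)
    simp [this] at hFy
end

section
/- Assume 1 < p < ∞, let f₀ be an extremal function for the p-modulus, and assume essinf_M f₀ > 0. Then for μ-almost every x ∈ M one has f₀(x)^{p−1} / J(x) = ∫_M (f₀^p / J) dν_{π(x)}. -/
open MeasureTheory ENNReal Filter

variable {M N : Type*}

theorem strictConvexOn_rpow_neg_Ici_one {s : ℝ} (hs : 0 < s) :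
    StrictConvexOn ℝ (Set.Ici 1) fun x : ℝ => x ^ (-s) := by
  have hpos : ∀ x ∈ Set.Ici (1 : ℝ), x ≠ 0 := fun x hx => (zero_lt_one.trans_le hx).ne'
  refine strictConvexOn_of_deriv2_pos (convex_Ici 1)
    (fun x hx => (Real.continuousAt_rpow_const x _ (.inl (hpos x hx))).continuousWithinAt) ?_
  intro x hx
  rw [interior_Ici] at hx
  have hx0 : 0 < x := zero_lt_one.trans hx
  rw [Real.iter_deriv_rpow_const]
  have : 0 < (descPochhammer ℝ 2).eval (-s) := by
    rw [descPochhammer_eval_eq_prod_range]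
    simp only [Finset.prod_range_succ, Finset.prod_range_zero]
    push_cast
    nlinarith
  positivity

/-- Strict Jensen inequality for `t ↦ (1 + t) ^ (-s)` on `[0, ∞)`. -/
theorem ae_eq_lintegral_or_rpow_neg_lt_lintegral {M : Type*} [MeasurableSpace M]
    {m : Measure M} [IsProbabilityMeasure m] {s : ℝ} (hs : 0 < s) {w : M → ℝ≥0∞}
    (hw : AEMeasurable w m) (hfin : ∫⁻ x, w x ∂m ≠ ∞) :
    (∀ᵐ x ∂m, w x = ∫⁻ z, w z ∂m) ∨
      (1 + ∫⁻ x, w x ∂m) ^ (-s) < ∫⁻ x, (1 + w x) ^ (-s) ∂m := by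
  have hlt : ∀ᵐ x ∂m, w x < ∞ := ae_lt_top' hw hfin
  have hint : Integrable (fun x => (w x).toReal) m := integrable_toReal_of_lintegral_ne_top hw hfin
  have hf : Integrable (fun x => 1 + (w x).toReal) m := (integrable_const 1).add hint
  have hge : ∀ x, 1 ≤ 1 + (w x).toReal := fun x => by simp
  have hbound : ∀ x, (1 + (w x).toReal) ^ (-s) ≤ 1 := fun x =>
    Real.rpow_le_one_of_one_le_of_nonpos (hge x) (by linarith)
  have hnn : ∀ x, 0 ≤ (1 + (w x).toReal) ^ (-s) := fun x => by positivity
  have hgi : Integrable ((fun t : ℝ => t ^ (-s)) ∘ fun x => 1 + (w x).toReal) m := by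
    refine Integrable.of_bound (C := 1) ?_ (.of_forall fun x => ?_)
    · exact ((hw.ennreal_toReal.const_add 1).pow_const (-s)).aestronglyMeasurable
    · simpa [abs_of_nonneg (hnn x)] using hbound x
  have hcont : ContinuousOn (fun t : ℝ => t ^ (-s)) (Set.Ici 1) := fun x hx =>
    (Real.continuousAt_rpow_const x _
      (.inl (zero_lt_one.trans_le hx).ne')).continuousWithinAt
  have havg : ∫ x, (1 + (w x).toReal) ∂m = 1 + (∫⁻ x, w x ∂m).toReal := by
    rw [integral_add (integrable_const 1) hint, integral_toReal hw hlt]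
    simp
  have hconv : ∀ t : ℝ≥0∞, t ≠ ∞ → (1 + t) ^ (-s) = ENNReal.ofReal ((1 + t.toReal) ^ (-s)) := by
    intro t ht
    rw [← ENNReal.ofReal_rpow_of_pos (by positivity), ENNReal.ofReal_add zero_le_one (by simp),
      ENNReal.ofReal_toReal ht, ENNReal.ofReal_one]
  rcases (strictConvexOn_rpow_neg_Ici_one hs).ae_eq_const_or_map_average_lt hcont isClosed_Ici
    (.of_forall hge) hf hgi with h | h
  · left
    filter_upwards [h, hlt] with x hx hx'
    rw [Function.const_apply, average_eq_integral, havg] at hx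
    exact (ENNReal.toReal_eq_toReal_iff' hx'.ne hfin).1 (add_left_cancel hx)
  · right
    rw [average_eq_integral, average_eq_integral, havg] at h
    rw [hconv _ hfin, lintegral_congr_ae (hlt.mono fun x hx => hconv _ hx.ne)]
    refine lt_of_lt_of_eq ?_ (ofReal_integral_eq_lintegral_ofReal hgi (.of_forall hnn))
    exact (ENNReal.ofReal_lt_ofReal_iff_of_nonneg (by positivity)).2 h

theorem one_le_lintegral_rpow {M : Type*} [MeasurableSpace M]
    {m : Measure M} [IsProbabilityMeasure m] {p : ℝ} (hp : 1 < p) {u : M → ℝ≥0∞}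
    (hu : AEMeasurable u m) (h1 : ∫⁻ x, u x ∂m = 1) : 1 ≤ ∫⁻ x, u x ^ p ∂m := by
  have h := ENNReal.lintegral_mul_le_Lp_mul_Lq m (Real.HolderConjugate.conjExponent hp) hu
    (aemeasurable_const (b := 1))
  simp only [Pi.mul_apply, mul_one, h1, ENNReal.one_rpow, lintegral_const, measure_univ] at h
  by_contra! hlt
  exact (h.trans_lt (ENNReal.rpow_lt_one hlt (by positivity))).false

theorem lintegral_one_add_rpow_neg_ne_top {M : Type*} [MeasurableSpace M]
    {m : Measure M} [IsFiniteMeasure m] {s : ℝ} (hs : 0 < s) (w : M → ℝ≥0∞) :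
    ∫⁻ x, (1 + w x) ^ (-s) ∂m ≠ ∞ := by
  refine ((lintegral_mono fun x => ENNReal.rpow_le_one_of_one_le_of_neg
    (x := 1 + w x) (z := -s) le_self_add (by linarith)).trans_lt ?_).ne
  simp

theorem rpow_neg_le_lintegral {M : Type*} [MeasurableSpace M]
    {m : Measure M} [IsProbabilityMeasure m] {s : ℝ} (hs : 0 < s) {w : M → ℝ≥0∞}
    (hw : AEMeasurable w m) (hfin : ∫⁻ x, w x ∂m ≠ ∞) :
    (1 + ∫⁻ x, w x ∂m) ^ (-s) ≤ ∫⁻ x, (1 + w x) ^ (-s) ∂m := by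
  rcases ae_eq_lintegral_or_rpow_neg_lt_lintegral hs hw hfin with h | h
  · rw [lintegral_congr_ae (h.mono fun x hx => congrArg (fun t => (1 + t) ^ (-s)) hx)]
    simp
  · exact h.le

theorem lintegral_one_add_rpow_neg_ne_zero {M : Type*} [MeasurableSpace M]
    {m : Measure M} [IsProbabilityMeasure m] {s : ℝ} (hs : 0 < s) {w : M → ℝ≥0∞}
    (hw : AEMeasurable w m) (hfin : ∫⁻ x, w x ∂m ≠ ∞) :
    ∫⁻ x, (1 + w x) ^ (-s) ∂m ≠ 0 :=
  ((ENNReal.rpow_pos (by simp) (by simp [hfin])).trans_le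
    (rpow_neg_le_lintegral hs hw hfin)).ne'

/-- The competitor `(1 + w) ^ (-1 / (p - 1))`, normalized to have mean one, has weighted energy
at most that of the constant `1`, with equality only if `w` is almost everywhere constant. -/
theorem lintegral_mul_rpow_div_le {M : Type*} [MeasurableSpace M]
    {m : Measure M} [IsProbabilityMeasure m] {p : ℝ} (hp : 1 < p) {w : M → ℝ≥0∞}
    (hw : AEMeasurable w m) (hfin : ∫⁻ x, w x ∂m ≠ ∞) {V : ℝ≥0∞}
    (hV : ∫⁻ x, (1 + w x) ^ (-(p - 1)⁻¹) ∂m = V) :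
    ∫⁻ x, w x * ((1 + w x) ^ (-(p - 1)⁻¹) / V) ^ p ∂m ≤ ∫⁻ x, w x ∂m ∧
      (∫⁻ x, w x * ((1 + w x) ^ (-(p - 1)⁻¹) / V) ^ p ∂m = ∫⁻ x, w x ∂m →
        ∀ᵐ x ∂m, w x = ∫⁻ z, w z ∂m) := by
  have hp' : 0 < p - 1 := by linarith
  have hs : 0 < (p - 1)⁻¹ := by positivity
  have hle := rpow_neg_le_lintegral hs hw hfin
  have hV0 := lintegral_one_add_rpow_neg_ne_zero hs hw hfin
  have hVtop := lintegral_one_add_rpow_neg_ne_top (m := m) hs w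
  have hlt := ae_eq_lintegral_or_rpow_neg_lt_lintegral hs hw hfin
  rw [hV] at hle hV0 hVtop hlt
  set s := (p - 1)⁻¹ with hsdef
  have hlt' : ∀ᵐ x ∂m, w x < ∞ := ae_lt_top' hw hfin
  set v : M → ℝ≥0∞ := fun x => (1 + w x) ^ (-s) with hv
  have hvm : AEMeasurable v m := (hw.const_add 1).pow_const _
  have hu1 : ∫⁻ x, v x / V ∂m = 1 := by
    simp only [div_eq_mul_inv]
    rw [lintegral_mul_const'' _ hvm, hV, ENNReal.mul_inv_cancel hV0 hVtop]
  have hone := one_le_lintegral_rpow hp (hvm.div_const V) hu1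
  have hsum : ∫⁻ x, (v x / V) ^ p ∂m + ∫⁻ x, w x * (v x / V) ^ p ∂m = V ^ (1 - p) := by
    rw [← lintegral_add_left' ((hvm.div_const V).pow_const p)]
    have : ∀ᵐ x ∂m, (v x / V) ^ p + w x * (v x / V) ^ p = v x * V ^ (-p) := by
      filter_upwards [hlt'] with x hx
      have h0 : 1 + w x ≠ 0 := by simp
      have ht : 1 + w x ≠ ∞ := by simp [hx.ne]
      rw [ENNReal.div_rpow_of_nonneg _ _ (by linarith), ENNReal.div_eq_inv_mul, ENNReal.rpow_neg]
      have : v x = (1 + w x) * v x ^ p := by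
        simp only [hv]
        rw [← ENNReal.rpow_mul]
        nth_rw 2 [← ENNReal.rpow_one (1 + w x)]
        rw [← ENNReal.rpow_add _ _ h0 ht]
        congr 1
        rw [hsdef]
        field_simp
        ring
      conv_rhs => rw [this]
      ring
    rw [lintegral_congr_ae this, lintegral_mul_const'' _ hvm, hV, sub_eq_add_neg,
      ENNReal.rpow_add _ _ hV0 hVtop, ENNReal.rpow_one]
  have hpow : ((1 + ∫⁻ x, w x ∂m) ^ (-s)) ^ (p - 1) = (1 + ∫⁻ x, w x ∂m)⁻¹ := by
    rw [← ENNReal.rpow_mul, show -s * (p - 1) = -1 by rw [hsdef]; field_simp,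
      ENNReal.rpow_neg_one]
  have hVinv : V ^ (1 - p) = (V ^ (p - 1))⁻¹ := by rw [← ENNReal.rpow_neg, neg_sub]
  constructor
  · have h := ENNReal.rpow_le_rpow hle hp'.le
    rw [hpow, ← ENNReal.inv_le_iff_inv_le, ← hVinv, ← hsum] at h
    exact (ENNReal.add_le_add_iff_left one_ne_top).1 ((add_le_add_left hone _).trans h)
  · intro heq
    refine hlt.resolve_right fun h => ?_
    have h := ENNReal.rpow_lt_rpow h hp'
    rw [hpow, ENNReal.inv_lt_iff_inv_lt, ← hVinv, ← hsum, heq] at h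
    exact (h.trans_le (add_le_add_left hone _)).false

theorem ae_iff_ae_ae_of_disintegration {M N : Type*} [MeasurableSpace M] [MeasurableSpace N]
    {μ : Measure M} {σ : Measure N} {ν : N → Measure M} (hν : Measurable ν)
    {J : M → ℝ≥0∞} (hJ : Measurable J) (hJtop : ∀ x, J x < ∞)
    (hFubini : ∀ f : M → ℝ≥0∞, Measurable f →
      ∫⁻ x, f x ∂μ = ∫⁻ y, (∫⁻ x, f x / J x ∂(ν y)) ∂σ)
    {P : M → Prop} (hP : MeasurableSet {x | P x}) :
    (∀ᵐ x ∂μ, P x) ↔ ∀ᵐ y ∂σ, ∀ᵐ x ∂(ν y), P x := by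
  have hm : Measurable ({x | P x}ᶜ.indicator (1 : M → ℝ≥0∞)) :=
    measurable_one.indicator hP.compl
  have hiff : ∀ x, {x | P x}ᶜ.indicator (1 : M → ℝ≥0∞) x = 0 ↔ P x := fun x => by
    simp
  have hmJ : Measurable fun x => {x | P x}ᶜ.indicator (1 : M → ℝ≥0∞) x / J x := hm.div hJ
  have hmν : Measurable fun y => ∫⁻ x, {x | P x}ᶜ.indicator (1 : M → ℝ≥0∞) x / J x ∂(ν y) :=
    (Measure.measurable_lintegral hmJ).comp hν
  calc (∀ᵐ x ∂μ, P x)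
      ↔ ∫⁻ x, {x | P x}ᶜ.indicator (1 : M → ℝ≥0∞) x ∂μ = 0 := by
        rw [lintegral_eq_zero_iff hm]
        exact eventually_congr (.of_forall fun x => (hiff x).symm)
    _ ↔ _ := by
        rw [hFubini _ hm, lintegral_eq_zero_iff hmν]
        refine eventually_congr (.of_forall fun y => ?_)
        rw [Pi.zero_apply, lintegral_eq_zero_iff hmJ]
        refine eventually_congr (.of_forall fun x => ?_)
        rw [Pi.zero_apply, ENNReal.div_eq_zero_iff, hiff, or_iff_left (hJtop x).ne]

/-- A competitor whose fiberwise energy nowhere exceeds that of an extremal function has the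
same energy on almost every fiber. -/
theorem IsExtremal.fiber_energy_eq {M N : Type*} [MeasurableSpace M] [MeasurableSpace N]
    {μ : Measure M} {σ : Measure N} {ν : N → Measure M} (hν : Measurable ν)
    {p : ℝ} (hp : 0 < p) {J : M → ℝ≥0∞} (hJ : Measurable J)
    (hFubini : ∀ f : M → ℝ≥0∞, Measurable f →
      ∫⁻ x, f x ∂μ = ∫⁻ y, (∫⁻ x, f x / J x ∂(ν y)) ∂σ)
    {f₀ f : M → ℝ≥0∞} (hf₀ : IsExtremal μ σ ν p f₀) (hf : Measurable f)
    (hadm : ∀ᵐ y ∂σ, 1 ≤ ∫⁻ x, f x ∂(ν y))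
    (hle : ∀ᵐ y ∂σ, ∫⁻ x, f x ^ p / J x ∂(ν y) ≤ ∫⁻ x, f₀ x ^ p / J x ∂(ν y)) :
    ∀ᵐ y ∂σ, ∫⁻ x, f x ^ p / J x ∂(ν y) = ∫⁻ x, f₀ x ^ p / J x ∂(ν y) := by
  obtain ⟨⟨hf₀m, hf₀fin, -⟩, hmin⟩ := hf₀
  have hFf := hFubini _ (hf.pow_const p)
  have hFf₀ := hFubini _ (hf₀m.pow_const p)
  have hlt : ∫⁻ x, f x ^ p ∂μ < ∞ := by
    rw [hFf]
    refine (lintegral_mono_ae hle).trans_lt ?_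
    rwa [← hFf₀]
  have hmod : (∫⁻ x, f₀ x ^ p ∂μ) ^ (1 / p) ≤ (∫⁻ x, f x ^ p ∂μ) ^ (1 / p) := by
    rw [hmin]
    exact iInf₂_le f ⟨hf, hlt, hadm.mono fun y hy _ => hy⟩
  rw [ENNReal.rpow_le_rpow_iff (by positivity), hFf, hFf₀] at hmod
  refine ae_eq_of_ae_le_of_lintegral_le hle (hFf ▸ hlt.ne) ?_ hmod
  exact ((Measure.measurable_lintegral ((hf₀m.pow_const p).div hJ)).comp hν).aemeasurable

theorem IsExtremal.lintegral_fiber_eq_one {M N : Type*} [MeasurableSpace M] [MeasurableSpace N]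
    {μ : Measure M} {σ : Measure N} {ν : N → Measure M} (hν : Measurable ν)
    {p : ℝ} (hp : 0 < p) {π : M → N} (hπ : Measurable π)
    (hleaf : ∀ᵐ y ∂σ, ∀ᵐ x ∂(ν y), π x = y)
    {J : M → ℝ≥0∞} (hJ : Measurable J) (hJtop : ∀ x, J x < ∞)
    (hFubini : ∀ f : M → ℝ≥0∞, Measurable f →
      ∫⁻ x, f x ∂μ = ∫⁻ y, (∫⁻ x, f x / J x ∂(ν y)) ∂σ)
    {f₀ : M → ℝ≥0∞} (hf₀ : IsExtremal μ σ ν p f₀)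
    (hfin : ∀ᵐ y ∂σ, ∫⁻ x, f₀ x ^ p / J x ∂(ν y) < ∞) :
    ∀ᵐ y ∂σ, ∫⁻ x, f₀ x ∂(ν y) = 1 := by
  have hf₀m := hf₀.1.1
  have hadm := hf₀.1.2.2
  have hem : Measurable fun x => f₀ x ^ p / J x := (hf₀m.pow_const p).div hJ
  set g : N → ℝ≥0∞ := fun y => ∫⁻ x, f₀ x ∂(ν y) with hg
  have hgm : Measurable g := (Measure.measurable_lintegral hf₀m).comp hν
  have hc1 : ∀ y, 1 ≤ g y → 1 ≤ min (g y) 2 := fun y hy => le_min hy one_le_two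
  have hctop : ∀ y, min (g y) 2 ≠ ∞ := fun y => ((min_le_right _ _).trans_lt (by simp)).ne
  have henergy : ∀ᵐ y ∂σ, ∫⁻ x, (f₀ x / min (g (π x)) 2) ^ p / J x ∂(ν y)
      = (∫⁻ x, f₀ x ^ p / J x ∂(ν y)) * (min (g y) 2 ^ p)⁻¹ := by
    filter_upwards [hleaf] with y hy
    rw [← lintegral_mul_const _ hem]
    refine lintegral_congr_ae (hy.mono fun x hx => ?_)
    simp only [hx]
    rw [ENNReal.div_rpow_of_nonneg _ _ hp.le]
    simp only [div_eq_mul_inv]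
    ring
  have heq := hf₀.fiber_energy_eq hν hp hJ hFubini
    (f := fun x => f₀ x / min (g (π x)) 2) (hf₀m.div ((hgm.comp hπ).min measurable_const))
    (by
      filter_upwards [hleaf, hadm] with y hy hy1
      have hy1 := hy1 trivial
      rw [lintegral_congr_ae (g := fun x => f₀ x * (min (g y) 2)⁻¹)
        (hy.mono fun x hx => by simp only [hx, div_eq_mul_inv]), lintegral_mul_const _ hf₀m,
        ← div_eq_mul_inv, ENNReal.le_div_iff_mul_le
          (.inl (zero_lt_one.trans_le (hc1 y hy1)).ne') (.inl (hctop y)), one_mul]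
      exact min_le_left _ _)
    (by
      filter_upwards [henergy, hadm] with y hy hy1
      rw [hy]
      refine mul_le_of_le_one_right' ?_
      rw [ENNReal.inv_le_one]
      exact ENNReal.one_le_rpow (hc1 y (hy1 trivial)) hp)
  filter_upwards [heq, henergy, hadm, hfin] with y hy hy' hy1 hyfin
  have hy1 := hy1 trivial
  have hne : ∫⁻ x, f₀ x ^ p / J x ∂(ν y) ≠ 0 := by
    intro h0
    rw [lintegral_eq_zero_iff hem] at h0
    have : g y = 0 := by
      rw [hg, lintegral_eq_zero_iff hf₀m]
      filter_upwards [h0] with x hx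
      rw [Pi.zero_apply, ENNReal.div_eq_zero_iff, or_iff_left (hJtop x).ne,
        ENNReal.rpow_eq_zero_iff_of_pos hp] at hx
      exact hx
    exact absurd (hy1.trans_eq this) (by simp)
  rw [hy', ENNReal.mul_eq_left hne hyfin.ne, ENNReal.inv_eq_one] at hy
  have hmin : min (g y) 2 = 1 := by
    refine le_antisymm (le_of_not_gt fun h => ?_) (hc1 y hy1)
    exact (ENNReal.one_lt_rpow h hp).ne' hy
  rcases min_choice (g y) 2 with h | h
  · exact h.symm.trans hmin
  · exact absurd (h.symm.trans hmin) (by simp)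

theorem statement_16
    {M N : Type*} [MeasurableSpace M] [MeasurableSpace N]
    (μ : Measure M) (σ : Measure N) [SigmaFinite μ] [SigmaFinite σ]
    (ν : N → Measure M) (hνsf : ∀ y, SigmaFinite (ν y))
    (hker : ∀ A : Set M, MeasurableSet A → Measurable fun y => ν y A)
    (p : ℝ) (hp : 1 < p)
    (π : M → N) (hπ : Measurable π)
    (hleaf : ∀ᵐ y ∂σ, ν y (Set.univ \ π ⁻¹' {y}) = 0)
    (J : M → ℝ≥0∞) (hJ : Measurable J) (hJ0 : ∀ x, 0 < J x) (hJtop : ∀ x, J x < ∞)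
    (hFubini : ∀ f : M → ℝ≥0∞, Measurable f →
      ∫⁻ x, f x ∂μ = ∫⁻ y, (∫⁻ x, f x / J x ∂(ν y)) ∂σ)
    (f₀ : M → ℝ≥0∞) (hf₀ : IsExtremal μ σ ν p f₀) (hinf : 0 < essInf f₀ μ) :
    ∀ᵐ x ∂μ, f₀ x ^ (p - 1) / J x = ∫⁻ z, f₀ z ^ p / J z ∂(ν (π x)) := by
  have hp0 : 0 < p := by linarith
  have hp1 : 0 < p - 1 := by linarith
  have hs : 0 < (p - 1)⁻¹ := by positivity
  have hν : Measurable ν := Measure.measurable_of_measurable_coe _ hker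
  have hf₀m := hf₀.1.1
  have hleaf' : ∀ᵐ y ∂σ, ∀ᵐ x ∂(ν y), π x = y := by
    filter_upwards [hleaf] with y hy
    rw [ae_iff]
    convert hy using 2
    ext x
    simp
  have hem : Measurable fun x => f₀ x ^ p / J x := (hf₀m.pow_const p).div hJ
  have hFm : Measurable fun y => ∫⁻ x, f₀ x ^ p / J x ∂(ν y) :=
    (Measure.measurable_lintegral hem).comp hν
  have hfin : ∀ᵐ y ∂σ, ∫⁻ x, f₀ x ^ p / J x ∂(ν y) < ∞ := by
    refine ae_lt_top hFm ?_
    rw [← hFubini _ (hf₀m.pow_const p)]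
    exact hf₀.1.2.1.ne
  have hone := hf₀.lintegral_fiber_eq_one hν hp0 hπ hleaf' hJ hJtop hFubini hfin
  have hpos : ∀ᵐ y ∂σ, ∀ᵐ x ∂(ν y), f₀ x ≠ 0 := by
    rw [← ae_iff_ae_ae_of_disintegration (P := fun x => f₀ x ≠ 0) hν hJ hJtop hFubini
      (measurableSet_eq_fun hf₀m measurable_const).compl]
    filter_upwards [ae_essInf_le (μ := μ) (f := f₀)] with x hx
    exact (hinf.trans_le hx).ne'
  set w : M → ℝ≥0∞ := fun x => f₀ x ^ (p - 1) / J x with hw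
  have hwm : Measurable w := (hf₀m.pow_const _).div hJ
  have hmul : ∀ x, f₀ x ^ p / J x = f₀ x * w x := fun x => by
    simp only [hw, div_eq_mul_inv, ← mul_assoc]
    nth_rw 2 [← ENNReal.rpow_one (f₀ x)]
    rw [← ENNReal.rpow_add_of_nonneg _ _ zero_le_one hp1.le, add_sub_cancel]
  have hdens : ∀ y (h : M → ℝ≥0∞), Measurable h →
      ∫⁻ x, h x ∂((ν y).withDensity f₀) = ∫⁻ x, f₀ x * h x ∂(ν y) := fun y h hh =>
    lintegral_withDensity_eq_lintegral_mul _ hf₀m hh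
  have hvm : Measurable fun x => (1 + w x) ^ (-(p - 1)⁻¹) := (hwm.const_add 1).pow_const _
  set V : N → ℝ≥0∞ := fun y => ∫⁻ x, f₀ x * (1 + w x) ^ (-(p - 1)⁻¹) ∂(ν y) with hV
  have hVm : Measurable V := (Measure.measurable_lintegral (hf₀m.mul hvm)).comp hν
  have hprob : ∀ᵐ y ∂σ, IsProbabilityMeasure ((ν y).withDensity f₀) :=
    hone.mono fun y hy => ⟨by rw [withDensity_apply _ .univ, Measure.restrict_univ, hy]⟩
  have hwfin : ∀ᵐ y ∂σ, ∫⁻ x, w x ∂((ν y).withDensity f₀) ≠ ∞ := by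
    filter_upwards [hfin] with y hy
    rw [hdens y w hwm]
    simpa only [hmul] using hy.ne
  have henergy : ∀ᵐ y ∂σ,
      ∫⁻ x, (f₀ x * ((1 + w x) ^ (-(p - 1)⁻¹) / V (π x))) ^ p / J x ∂(ν y) =
        ∫⁻ x, w x * ((1 + w x) ^ (-(p - 1)⁻¹) / V y) ^ p ∂((ν y).withDensity f₀) := by
    filter_upwards [hleaf'] with y hy
    rw [hdens y (fun x => w x * ((1 + w x) ^ (-(p - 1)⁻¹) / V y) ^ p)
      (hwm.mul ((hvm.div_const _).pow_const p))]
    refine lintegral_congr_ae (hy.mono fun x hx => ?_)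
    simp only [hx]
    rw [ENNReal.mul_rpow_of_nonneg _ _ hp0.le, ← mul_assoc, ← hmul, ENNReal.mul_div_right_comm]
  have hgap : ∀ᵐ y ∂σ,
      ∫⁻ x, w x * ((1 + w x) ^ (-(p - 1)⁻¹) / V y) ^ p ∂((ν y).withDensity f₀) ≤
          ∫⁻ x, w x ∂((ν y).withDensity f₀) ∧
        (∫⁻ x, w x * ((1 + w x) ^ (-(p - 1)⁻¹) / V y) ^ p ∂((ν y).withDensity f₀) =
            ∫⁻ x, w x ∂((ν y).withDensity f₀) →
          ∀ᵐ x ∂((ν y).withDensity f₀), w x = ∫⁻ z, w z ∂((ν y).withDensity f₀)) := by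
    filter_upwards [hprob, hwfin] with y hy hy'
    exact lintegral_mul_rpow_div_le hp hwm.aemeasurable hy' (hdens y _ hvm)
  have heq := hf₀.fiber_energy_eq hν hp0 hJ hFubini
    (f := fun x => f₀ x * ((1 + w x) ^ (-(p - 1)⁻¹) / V (π x)))
    (hf₀m.mul (hvm.div (hVm.comp hπ)))
    (by
      filter_upwards [hleaf', hprob, hwfin] with y hy hyp hyw
      have hVy : ∫⁻ x, f₀ x * (1 + w x) ^ (-(p - 1)⁻¹) ∂(ν y) = V y := rfl
      have h0 : V y ≠ 0 := by
        rw [← hdens y _ hvm] at hVy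
        exact hVy ▸ lintegral_one_add_rpow_neg_ne_zero hs hwm.aemeasurable hyw
      have ht : V y ≠ ∞ := by
        rw [← hdens y _ hvm] at hVy
        exact hVy ▸ lintegral_one_add_rpow_neg_ne_top hs w
      have hfv : Measurable fun x => f₀ x * (1 + w x) ^ (-(p - 1)⁻¹) := hf₀m.mul hvm
      rw [lintegral_congr_ae (g := fun x => f₀ x * (1 + w x) ^ (-(p - 1)⁻¹) * (V y)⁻¹)
        (hy.mono fun x hx => by simp only [hx, div_eq_mul_inv, mul_assoc]),
        lintegral_mul_const _ hfv]
      exact (ENNReal.mul_inv_cancel h0 ht).ge)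
    (by
      filter_upwards [henergy, hgap] with y hy hy'
      simp only [hy, hmul, ← hdens y w hwm]
      exact hy'.1)
  rw [ae_iff_ae_ae_of_disintegration
    (P := fun x => f₀ x ^ (p - 1) / J x = ∫⁻ z, f₀ z ^ p / J z ∂(ν (π x)))
    hν hJ hJtop hFubini (measurableSet_eq_fun hwm (hFm.comp hπ))]
  filter_upwards [heq, henergy, hgap, hleaf', hpos] with y hy hy' hyg hyl hypos
  have hEw : ∫⁻ x, f₀ x ^ p / J x ∂(ν y) = ∫⁻ x, w x ∂((ν y).withDensity f₀) := by
    simp only [hdens y w hwm, hmul]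
  have hconst := (ae_withDensity_iff hf₀m).1 (hyg.2 (hy'.symm.trans (hy.trans hEw)))
  filter_upwards [hconst, hyl, hypos] with x hx hxl hx0
  rw [hxl, hEw]
  exact hx hx0
end
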